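/- arXiv:2602.14532 — 4 statements merged into one kernel-verified Lean document; each statement's English description precedes it below -/
import Mathlib

section
/- For a partition σ of k with multiplicities m_j(σ) and number of parts l(σ), the number of noncrossing partitions of {1,…,k} whose blocks have sizes given by σ equals k! / ( (k − l(σ) + 1)! · ∏_{j≥1} m_j(σ)! ). -/
open Finset

/-- `x` and `y` lie in a common block of the set partition `π`. -/
def SameBlock {k : ℕ} (π : Finpartition (Finset.univ : Finset (Fin k))) (x y : Fin k) :
    Prop :=
  ∃ B ∈ π.parts, x ∈ B ∧ y ∈ B

/-- A set partition of `{1,…,k}` is noncrossing if there are no `a < b < c < d` with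
`a, c` in one block and `b, d` in a different block. -/
def IsNoncrossing {k : ℕ} (π : Finpartition (Finset.univ : Finset (Fin k))) : Prop :=
  ∀ a b c d : Fin k, a < b → b < c → c < d →
    SameBlock π a c → SameBlock π b d → SameBlock π a b

/-- `IsBracketing n L` says that `L` is the tail, from position `n` on, of the sequence which
assigns to each position the least element of its block in a noncrossing partition. -/
def IsBracketing : ℕ → List ℕ → Prop
  | _, [] => True
  | n, x :: L => x ≤ n ∧ (∀ y ∈ L, y ≤ n → y ≤ x) ∧ IsBracketing (n + 1) L

/-- The multiplicities in `L` of the labels that are at least `n`. -/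
def openedCounts (n : ℕ) (L : List ℕ) : Multiset ℕ :=
  (L.toFinset.filter (n ≤ ·)).val.map fun x => L.count x

/-- The sequences of length `N` satisfying `IsBracketing n` whose labels below `n` form the
list `st`, and whose remaining labels have multiplicities `M`. -/
def bracketings : ℕ → ℕ → List ℕ → Multiset ℕ → Finset (List ℕ)
  | 0, _, st, M => if st = [] ∧ M = 0 then {[]} else ∅
  | N + 1, n, st, M =>
    (match st with
      | [] => ∅
      | t :: st' => (bracketings N (n + 1) st' M).image (List.cons t)) ∪
    M.toFinset.biUnion fun a =>
      (bracketings N (n + 1) (List.replicate (a - 1) n ++ st) (M.erase a)).image (List.cons n)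

theorem List.Pairwise.eq_replicate_append {n : ℕ} {l : List ℕ} (hl : l.Pairwise (· ≥ ·))
    (hn : ∀ x ∈ l, x ≤ n) : l = List.replicate (l.count n) n ++ l.filter (· < n) := by
  induction l with
  | nil => simp
  | cons y l ih =>
    rw [List.pairwise_cons] at hl
    have hy := hn y (by simp)
    rcases hy.eq_or_lt with rfl | hy
    · have := ih hl.2 (fun x hx => hn x (by simp [hx]))
      simpa [List.replicate_succ] using this
    · have h1 : (y :: l).count n = 0 := by
        rw [List.count_eq_zero]
        intro h
        rcases List.mem_cons.1 h with h | h
        · omega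
        · have := hl.1 _ h
          omega
      rw [h1, List.replicate_zero, List.nil_append, eq_comm, List.filter_eq_self]
      intro a ha
      rcases List.mem_cons.1 ha with h | h
      · simpa [h] using hy
      · have := hl.1 _ h
        simp; omega

theorem IsBracketing.pairwise_filter {n : ℕ} {L : List ℕ} (h : IsBracketing n L) :
    (L.filter (· < n)).Pairwise (· ≥ ·) := by
  induction L generalizing n with
  | nil => simp
  | cons x L ih =>
    obtain ⟨-, h2, h3⟩ := h
    have key : (L.filter (· < n)).Pairwise (· ≥ ·) := by
      have := (ih h3).filter (· < n)
      rw [List.filter_filter] at this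
      convert this using 2
      ext a
      simp; omega
    rw [List.filter_cons]
    split_ifs with hx
    · refine List.pairwise_cons.2 ⟨fun a ha => ?_, key⟩
      simp only [List.mem_filter, decide_eq_true_eq] at ha
      exact h2 a ha.1 ha.2.le
    · exact key

theorem IsBracketing.filter_lt_succ {n : ℕ} {L : List ℕ} (h : IsBracketing (n + 1) L) :
    L.filter (· < n + 1) = List.replicate (L.count n) n ++ L.filter (· < n) := by
  have := h.pairwise_filter.eq_replicate_append (n := n) (by simp)
  rw [List.filter_filter, List.count_filter (by simp)] at this
  rw [this]
  congr 2
  ext a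
  simp; omega

theorem openedCounts_cons_of_lt {n x : ℕ} {L : List ℕ} (hx : x < n) (hn : n ∉ L) :
    openedCounts n (x :: L) = openedCounts (n + 1) L := by
  have : (x :: L).toFinset.filter (n ≤ ·) = L.toFinset.filter (n + 1 ≤ ·) := by
    ext a
    simp only [List.toFinset_cons, Finset.mem_filter, Finset.mem_insert, List.mem_toFinset]
    constructor
    · rintro ⟨rfl | h, h'⟩
      · omega
      · have : a ≠ n := by rintro rfl; exact hn h
        exact ⟨h, by omega⟩
    · rintro ⟨h, h'⟩
      exact ⟨.inr h, by omega⟩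
  rw [openedCounts, this]
  refine Multiset.map_congr rfl fun a ha => ?_
  simp only [Finset.mem_val, Finset.mem_filter] at ha
  rw [List.count_cons_of_ne (by omega)]

theorem openedCounts_cons_self {n : ℕ} {L : List ℕ} :
    openedCounts n (n :: L) = (L.count n + 1) ::ₘ openedCounts (n + 1) L := by
  have : (n :: L).toFinset.filter (n ≤ ·) =
      Finset.cons n (L.toFinset.filter (n + 1 ≤ ·)) (by simp) := by
    ext a
    simp only [List.toFinset_cons, Finset.mem_filter, Finset.mem_insert, List.mem_toFinset,
      Finset.mem_cons]
    constructor
    · rintro ⟨rfl | h, h'⟩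
      · simp
      · by_cases h : a = n
        · exact .inl h
        · exact .inr ⟨‹_›, by omega⟩
    · rintro (rfl | ⟨h, h'⟩)
      · simp
      · exact ⟨.inr h, by omega⟩
  rw [openedCounts, this, Finset.cons_val, Multiset.map_cons, List.count_cons_self]
  congr 1
  refine Multiset.map_congr rfl fun a ha => ?_
  simp only [Finset.mem_val, Finset.mem_filter] at ha
  rw [List.count_cons_of_ne (by omega)]

theorem pairwise_replicate_append {n a : ℕ} {st : List ℕ} (hst : ∀ x ∈ st, x < n)
    (hs : st.Pairwise (· ≥ ·)) : (List.replicate a n ++ st).Pairwise (· ≥ ·) := by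
  refine List.pairwise_append.2 ⟨by simp [List.pairwise_replicate], hs, fun x hx y hy => ?_⟩
  rw [List.eq_of_mem_replicate hx]
  exact (hst y hy).le

theorem mem_bracketings {N n : ℕ} {st : List ℕ} {M : Multiset ℕ} {L : List ℕ} (h0 : 0 ∉ M)
    (hst : ∀ x ∈ st, x < n) (hs : st.Pairwise (· ≥ ·)) :
    L ∈ bracketings N n st M ↔
      L.length = N ∧ IsBracketing n L ∧ L.filter (· < n) = st ∧ openedCounts n L = M := by
  induction N generalizing n st M L with
  | zero =>
    rw [bracketings, List.length_eq_zero_iff]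
    split_ifs with h
    · obtain ⟨rfl, rfl⟩ := h
      rw [Finset.mem_singleton]
      refine ⟨?_, fun h => h.1⟩
      rintro rfl
      simp [IsBracketing, openedCounts]
    · simp only [Finset.notMem_empty, false_iff]
      rintro ⟨rfl, -, rfl, rfl⟩
      exact h (by simp [openedCounts])
  | succ N ih =>
    have ih2 : ∀ a (L' : List ℕ), L' ∈ bracketings N (n + 1) (List.replicate a n ++ st)
        (M.erase (a + 1)) ↔ L'.length = N ∧ IsBracketing (n + 1) L' ∧
          (L'.filter (· < n) = st ∧ L'.count n = a) ∧
          openedCounts (n + 1) L' = M.erase (a + 1) := by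
      intro a L'
      rw [ih (fun h => h0 (Multiset.mem_of_mem_erase h)) ?_ (pairwise_replicate_append hst hs)]
      · refine and_congr_right fun _ => and_congr_right fun hL => and_congr_left fun _ => ?_
        rw [hL.filter_lt_succ]
        refine ⟨fun h => ?_, fun h => by rw [h.1, h.2]⟩
        have h1 := congrArg (List.filter (· < n)) h
        have h2 := congrArg (List.count n) h
        have e1 : ∀ b, (List.replicate b n).filter (· < n) = [] := by simp
        have e2 : (L'.filter (· < n)).count n = 0 := by simp [List.count_eq_zero]
        have e3 : st.count n = 0 := List.count_eq_zero.2 fun h => (hst n h).false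
        have e4 : st.filter (· < n) = st := by simpa using hst
        rw [List.filter_append, List.filter_append, e1, e1, List.filter_filter, e4] at h1
        rw [List.count_append, List.count_append, e2, e3] at h2
        simp at h1 h2
        exact ⟨h1, h2⟩
      · intro x hx
        rcases List.mem_append.1 hx with hx | hx
        · rw [List.eq_of_mem_replicate hx]; omega
        · have := hst x hx
          omega
    have hM : ∀ L', (∃ a ∈ M.toFinset, L' ∈ bracketings N (n + 1)
        (List.replicate (a - 1) n ++ st) (M.erase a)) ↔
        L'.length = N ∧ IsBracketing (n + 1) L' ∧ L'.filter (· < n) = st ∧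
          openedCounts n (n :: L') = M := by
      intro L'
      rw [openedCounts_cons_self]
      constructor
      · rintro ⟨a, ha, h⟩
        rw [Multiset.mem_toFinset] at ha
        obtain ⟨b, rfl⟩ : ∃ b, a = b + 1 :=
          Nat.exists_eq_succ_of_ne_zero (by rintro rfl; exact h0 ha)
        rw [Nat.add_sub_cancel, ih2] at h
        obtain ⟨h1, h2, ⟨h3, h4⟩, h5⟩ := h
        exact ⟨h1, h2, h3, by rw [h4, h5, Multiset.cons_erase ha]⟩
      · rintro ⟨h1, h2, h3, h4⟩
        refine ⟨L'.count n + 1, by simp [← h4], ?_⟩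
        rw [Nat.add_sub_cancel, ih2]
        exact ⟨h1, h2, ⟨h3, rfl⟩, by rw [← h4, Multiset.erase_cons_head]⟩
    have hbi : ∀ L, (L ∈ M.toFinset.biUnion fun a => (bracketings N (n + 1)
        (List.replicate (a - 1) n ++ st) (M.erase a)).image (List.cons n)) ↔
        ∃ L', L = n :: L' ∧ L'.length = N ∧ IsBracketing (n + 1) L' ∧ L'.filter (· < n) = st ∧
          openedCounts n (n :: L') = M := by
      intro L
      simp only [← hM, Finset.mem_biUnion, Finset.mem_image]
      constructor
      · rintro ⟨a, ha, L', hL', rfl⟩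
        exact ⟨L', rfl, a, ha, hL'⟩
      · rintro ⟨L', rfl, a, ha, hL'⟩
        exact ⟨a, ha, L', hL', rfl⟩
    rw [bracketings.eq_def]
    simp only [Finset.mem_union]
    rw [hbi]
    constructor
    · rintro (h | ⟨L', rfl, h1, h2, h3, h4⟩)
      · rcases st with - | ⟨t, st⟩
        · simp at h
        · simp only [Finset.mem_image] at h
          obtain ⟨L', hL', rfl⟩ := h
          rw [List.pairwise_cons] at hs
          have ht := hst t (by simp)
          have hst' : ∀ x ∈ st, x < n := fun x hx => hst x (by simp [hx])
          rw [ih h0 (fun x hx => (hst' x hx).trans (Nat.lt_succ_self n)) hs.2] at hL'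
          obtain ⟨h1, h2, h3, h4⟩ := hL'
          have hle : ∀ y ∈ L', y ≤ n → y ∈ st := by
            intro y hy hyn
            rw [← h3]
            simp [hy]; omega
          have hn : n ∉ L' := fun h => (hst' n (hle n h le_rfl)).false
          refine ⟨by simp [h1], ⟨ht.le, fun y hy hyn => hs.1 y (hle y hy hyn), h2⟩, ?_, ?_⟩
          · rw [List.filter_cons_of_pos (by simpa using ht)]
            rw [h2.filter_lt_succ, List.count_eq_zero.2 hn] at h3
            simpa using h3
          · rw [openedCounts_cons_of_lt ht hn, h4]
      · exact ⟨by simp [h1], ⟨le_rfl, fun _ _ h => h, h2⟩, by simpa using h3, h4⟩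
    · rintro ⟨h1, h2, h3, h4⟩
      rcases L with - | ⟨x, L'⟩
      · simp at h1
      obtain ⟨hx, hy, hL'⟩ := h2
      rw [List.length_cons, Nat.add_right_cancel_iff] at h1
      rcases hx.eq_or_lt with rfl | hx
      · exact .inr ⟨L', rfl, h1, hL', by simpa using h3, h4⟩
      · left
        have hn : n ∉ L' := fun h => by have := hy n h le_rfl; omega
        rw [List.filter_cons_of_pos (by simpa using hx)] at h3
        subst h3
        simp only [Finset.mem_image]
        refine ⟨L', ?_, rfl⟩
        rw [List.pairwise_cons] at hs
        rw [ih h0 (fun y hy => by have := hst y (by simp [hy]); omega) hs.2]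
        refine ⟨h1, hL', ?_, by rw [← h4, openedCounts_cons_of_lt hx hn]⟩
        rw [hL'.filter_lt_succ, List.count_eq_zero.2 hn]
        simp

theorem prod_factorial_count_erase {M : Multiset ℕ} {s : Finset ℕ} {a : ℕ} (ha : a ∈ M)
    (has : a ∈ s) : ∏ j ∈ s, (M.count j).factorial =
      M.count a * ∏ j ∈ s, ((M.erase a).count j).factorial := by
  have h : ∏ j ∈ s.erase a, ((M.erase a).count j).factorial =
      ∏ j ∈ s.erase a, (M.count j).factorial :=
    Finset.prod_congr rfl fun j hj => by
      rw [Multiset.count_erase_of_ne (Finset.ne_of_mem_erase hj)]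
  rw [← Finset.mul_prod_erase s _ has, ← Finset.mul_prod_erase s _ has, h,
    Multiset.count_erase_self, ← mul_assoc,
    Nat.mul_factorial_pred (Multiset.count_pos.2 ha).ne']

theorem card_bracketings_succ {N n : ℕ} {st : List ℕ} {M : Multiset ℕ} (h0 : 0 ∉ M)
    (hst : ∀ x ∈ st, x < n) (hs : st.Pairwise (· ≥ ·)) :
    #(bracketings (N + 1) n st M) =
      (match st with
        | [] => 0
        | _ :: st' => #(bracketings N (n + 1) st' M)) +
      ∑ a ∈ M.toFinset,
        #(bracketings N (n + 1) (List.replicate (a - 1) n ++ st) (M.erase a)) := by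
  rw [bracketings.eq_def]
  simp only
  rw [Finset.card_union_of_disjoint, Finset.card_biUnion]
  · congr 1
    · rcases st with - | ⟨t, st⟩
      · rfl
      · exact Finset.card_image_of_injective _ List.cons_injective
    · exact Finset.sum_congr rfl fun a _ =>
        Finset.card_image_of_injective _ List.cons_injective
  · intro a ha b hb hab
    refine Finset.disjoint_left.2 fun L hLa hLb => ?_
    rw [Finset.mem_image] at hLa hLb
    obtain ⟨L, hLa, rfl⟩ := hLa
    obtain ⟨L', hLb, h⟩ := hLb
    rw [List.cons_inj_right] at h
    subst h
    have hlt : ∀ c, ∀ x ∈ List.replicate c n ++ st, x < n + 1 := by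
      intro c x hx
      rcases List.mem_append.1 hx with hx | hx
      · rw [List.eq_of_mem_replicate hx]; omega
      · have := hst x hx
        omega
    have hne : ∀ c ∈ M.toFinset, c ≠ 0 := by
      rintro c hc rfl
      exact h0 (Multiset.mem_toFinset.1 hc)
    have herase : ∀ c, 0 ∉ M.erase c := fun c h => h0 (Multiset.mem_of_mem_erase h)
    rw [mem_bracketings (herase _) (hlt _) (pairwise_replicate_append hst hs)] at hLa hLb
    have h := congrArg List.length (hLa.2.2.1.symm.trans hLb.2.2.1)
    have := hne a ha
    have := hne b hb
    simp at h
    omega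
  · rw [Finset.disjoint_left]
    intro L hL hL'
    simp only [Finset.mem_biUnion, Finset.mem_image] at hL'
    obtain ⟨a, -, L', -, rfl⟩ := hL'
    rcases st with - | ⟨t, st⟩
    · simp at hL
    · simp only [Finset.mem_image, List.cons.injEq] at hL
      obtain ⟨-, -, h, -⟩ := hL
      exact (hst t (by simp)).ne h

theorem card_le_sum_of_zero_notMem {M : Multiset ℕ} (h0 : 0 ∉ M) : M.card ≤ M.sum := by
  have := Multiset.card_nsmul_le_sum (s := M) (a := 1)
    (fun x hx => Nat.one_le_iff_ne_zero.2 (by rintro rfl; exact h0 hx))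
  simpa using this

theorem card_bracketings {N n : ℕ} {st : List ℕ} {M : Multiset ℕ} {s : Finset ℕ}
    (hMs : ∀ x ∈ M, x ∈ s) (h0 : 0 ∉ M) (hst : ∀ x ∈ st, x < n) (hs : st.Pairwise (· ≥ ·))
    (hsum : M.sum + st.length = N) :
    #(bracketings N n st M) * ((N - M.card + 1).factorial * ∏ j ∈ s, (M.count j).factorial) =
      (st.length + 1) * N.factorial := by
  induction N generalizing n st M with
  | zero =>
    have hc := card_le_sum_of_zero_notMem h0
    obtain rfl : st = [] := List.length_eq_zero_iff.1 (by omega)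
    obtain rfl : M = 0 := Multiset.card_eq_zero.1 (by omega)
    simp [bracketings]
  | succ N ih =>
    have hc := card_le_sum_of_zero_notMem h0
    have hA : (match (generalizing := false) st with
        | [] => 0
        | _ :: st' => #(bracketings N (n + 1) st' M)) *
          ((N + 1 - M.card + 1).factorial * ∏ j ∈ s, (M.count j).factorial) =
        (N + 1 - M.card + 1) * st.length * N.factorial := by
      rcases st with - | ⟨t, st⟩
      · simp
      · rw [List.pairwise_cons] at hs
        rw [List.length_cons] at hsum
        have := ih (n := n + 1) hMs h0 (fun x hx => by have := hst x (by simp [hx]); omega)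
          hs.2 (by omega)
        rw [show N + 1 - M.card = N - M.card + 1 by omega, Nat.factorial_succ, List.length_cons,
          mul_assoc _ _ N.factorial, ← this]
        ring
    have hB : ∀ a ∈ M.toFinset,
        #(bracketings N (n + 1) (List.replicate (a - 1) n ++ st) (M.erase a)) *
          ((N + 1 - M.card + 1).factorial * ∏ j ∈ s, (M.count j).factorial) =
        M.count a * (st.length + a) * N.factorial := by
      intro a ha
      rw [Multiset.mem_toFinset] at ha
      have ha0 : a ≠ 0 := by rintro rfl; exact h0 ha
      have h1 := Multiset.card_erase_add_one ha
      have h2 : a + (M.erase a).sum = M.sum := by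
        rw [← Multiset.sum_cons, Multiset.cons_erase ha]
      have := ih (n := n + 1) (st := List.replicate (a - 1) n ++ st) (M := M.erase a)
        (fun x hx => hMs x (Multiset.mem_of_mem_erase hx))
        (fun h => h0 (Multiset.mem_of_mem_erase h))
        (fun x hx => by
          rcases List.mem_append.1 hx with hx | hx
          · rw [List.eq_of_mem_replicate hx]; omega
          · have := hst x hx
            omega)
        (pairwise_replicate_append hst hs)
        (by rw [List.length_append, List.length_replicate]; omega)
      rw [List.length_append, List.length_replicate,
        show a - 1 + st.length + 1 = st.length + a by omega,
        show N - (M.erase a).card = N + 1 - M.card by omega] at this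
      rw [prod_factorial_count_erase ha (hMs a ha), mul_assoc _ _ N.factorial, ← this]
      ring
    have hC : ∑ a ∈ M.toFinset, M.count a * (st.length + a) = M.card * st.length + M.sum := by
      have := Finset.sum_multiset_map_count M (fun a => st.length + a)
      simp only [smul_eq_mul] at this
      rw [← this, Multiset.sum_map_add, Multiset.map_const', Multiset.sum_replicate,
        Multiset.map_id', smul_eq_mul]
    rw [card_bracketings_succ h0 hst hs, add_mul, hA, Finset.sum_mul, Finset.sum_congr rfl hB,
      ← Finset.sum_mul, hC, ← add_mul, Nat.factorial_succ, ← mul_assoc]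
    congr 1
    obtain ⟨z, hz⟩ := Nat.exists_eq_add_of_le (show M.card ≤ N + 1 by omega)
    rw [hz, Nat.add_sub_cancel_left]
    have : M.sum = M.card + z - st.length := by omega
    zify [show st.length ≤ M.card + z by omega] at this ⊢
    rw [this]
    ring

theorem isBracketing_iff {n : ℕ} {L : List ℕ} :
    IsBracketing n L ↔ ∀ j (hj : j < L.length), L[j] ≤ n + j ∧
      ∀ i (hi : i ≤ j), L[j] ≤ n + i → L[j] ≤ L[i] := by
  induction L generalizing n with
  | nil => simp [IsBracketing]
  | cons x L ih =>
    rw [IsBracketing, ih]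
    constructor
    · rintro ⟨h1, h2, h3⟩ (- | j) hj
      · refine ⟨h1, fun i hi _ => ?_⟩
        obtain rfl : i = 0 := by omega
        rfl
      · have hj' : j < L.length := by simpa using hj
        obtain ⟨h4, h5⟩ := h3 j hj'
        simp only [List.getElem_cons_succ]
        refine ⟨by omega, ?_⟩
        rintro (- | i) hi h
        · exact h2 _ (List.getElem_mem _) (by simpa using h)
        · exact h5 i (by omega) (by omega)
    · intro h
      refine ⟨(h 0 (by simp)).1, fun y hy hyn => ?_, fun j hj => ?_⟩
      · obtain ⟨j, hj, rfl⟩ := List.getElem_of_mem hy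
        exact (h (j + 1) (by simpa using hj)).2 0 (by omega) (by simpa using hyn)
      · obtain ⟨h1, h2⟩ := h (j + 1) (by simpa using hj)
        simp only [List.getElem_cons_succ] at h1 h2
        refine ⟨by omega, fun i hi hle => ?_⟩
        exact h2 (i + 1) (by omega) (by omega)

/-- The least element of the block of `i`. -/
def blockMin {k : ℕ} (π : Finpartition (Finset.univ : Finset (Fin k))) (i : Fin k) : Fin k :=
  (π.part i).min' ⟨i, π.mem_part_self.2 (Finset.mem_univ i)⟩

section BlockMin

variable {k : ℕ} {π : Finpartition (Finset.univ : Finset (Fin k))} {i j : Fin k}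

theorem sameBlock_iff : SameBlock π i j ↔ π.part i = π.part j := by
  rw [← π.mem_part_iff_part_eq_part (Finset.mem_univ i) (Finset.mem_univ j),
    Finpartition.mem_part_iff_exists, SameBlock]

theorem part_blockMin : π.part (blockMin π i) = π.part i := by
  rw [← π.mem_part_iff_part_eq_part (Finset.mem_univ _) (Finset.mem_univ _)]
  exact Finset.min'_mem _ _

theorem blockMin_eq_iff : blockMin π i = blockMin π j ↔ π.part i = π.part j := by
  constructor
  · intro h
    rw [← part_blockMin, h, part_blockMin]
  · intro h
    simp only [blockMin, h]

theorem blockMin_le_of_mem (h : j ∈ π.part i) : blockMin π i ≤ j :=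
  Finset.min'_le _ _ h

theorem blockMin_le : blockMin π i ≤ i :=
  blockMin_le_of_mem (π.mem_part_self.2 (Finset.mem_univ i))

theorem blockMin_blockMin : blockMin π (blockMin π i) = blockMin π i :=
  blockMin_eq_iff.2 part_blockMin

theorem isNoncrossing_iff :
    IsNoncrossing π ↔ ∀ i j, blockMin π j ≤ i → i ≤ j → blockMin π j ≤ blockMin π i := by
  simp only [IsNoncrossing, sameBlock_iff, ← blockMin_eq_iff]
  constructor
  · intro h i j hji hij
    by_contra! hlt
    have h1 : blockMin π j < i := by
      refine lt_of_le_of_ne hji fun h => ?_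
      rw [← h, blockMin_blockMin] at hlt
      exact hlt.false
    have h2 : i < j := lt_of_le_of_ne hij (by rintro rfl; exact hlt.false)
    have := h _ _ _ _ hlt h1 h2 blockMin_blockMin blockMin_blockMin
    rw [blockMin_blockMin, blockMin_blockMin] at this
    exact hlt.ne this
  · intro h a b c d hab hbc hcd hac hbd
    apply le_antisymm
    · rw [hac]
      exact h b c (hac ▸ blockMin_le.trans hab.le) hbc.le
    · rw [hac, hbd]
      exact h c d (hbd ▸ blockMin_le.trans hbc.le) hcd.le

/-- The list whose `i`-th entry is the least element of the block of `i`. -/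
def minLabels (π : Finpartition (Finset.univ : Finset (Fin k))) : List ℕ :=
  List.ofFn fun i => (blockMin π i : ℕ)

theorem isBracketing_minLabels_iff : IsBracketing 0 (minLabels π) ↔ IsNoncrossing π := by
  rw [isBracketing_iff, isNoncrossing_iff]
  simp only [minLabels, List.length_ofFn, List.getElem_ofFn, zero_add]
  constructor
  · intro h i j h1 h2
    exact (h j j.2).2 i h2 h1
  · intro h j hj
    exact ⟨blockMin_le (i := ⟨j, hj⟩), fun i hi hle => h ⟨i, by omega⟩ ⟨j, hj⟩ hle hi⟩

theorem count_minLabels (x : ℕ) :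
    (minLabels π).count x = #{i : Fin k | (blockMin π i : ℕ) = x} := by
  have : ((minLabels π : List ℕ) : Multiset ℕ) =
      (Finset.univ : Finset (Fin k)).val.map fun i => (blockMin π i : ℕ) := by
    rw [Fin.univ_val_map]; rfl
  rw [← Multiset.coe_count, this, Multiset.count_map, Finset.card_def, Finset.filter_val]
  simp only [eq_comm]

theorem openedCounts_minLabels :
    openedCounts 0 (minLabels π) = Multiset.map Finset.card π.parts.val := by
  symm
  refine Multiset.map_eq_map_of_bij_of_nodup _ _ π.parts.nodup (Finset.nodup _)
    (fun B hB => (B.min' (π.nonempty_of_mem_parts hB) : Fin k).val) ?_ ?_ ?_ ?_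
  · intro B hB
    have hmem := B.min'_mem (π.nonempty_of_mem_parts hB)
    have := π.part_eq_of_mem hB hmem
    simp only [Finset.mem_val, Finset.mem_filter, List.mem_toFinset, minLabels, List.mem_ofFn',
      Set.mem_range, Nat.zero_le, and_true]
    exact ⟨B.min' (π.nonempty_of_mem_parts hB), by simp only [blockMin, this]⟩
  · intro B hB C hC h
    have h := Fin.ext h
    have hmem := B.min'_mem (π.nonempty_of_mem_parts hB)
    exact π.eq_of_mem_parts hB hC hmem (h ▸ C.min'_mem _)
  · intro x hx
    simp only [Finset.mem_val, Finset.mem_filter, List.mem_toFinset, minLabels, List.mem_ofFn',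
      Set.mem_range, Nat.zero_le, and_true] at hx
    obtain ⟨i, rfl⟩ := hx
    exact ⟨π.part i, π.part_mem.2 (Finset.mem_univ i), rfl⟩
  · intro B hB
    rw [count_minLabels]
    congr 1
    ext i
    have hmem := B.min'_mem (π.nonempty_of_mem_parts hB)
    have hp := π.part_eq_of_mem hB hmem
    have : B.min' (π.nonempty_of_mem_parts hB) =
        blockMin π (B.min' (π.nonempty_of_mem_parts hB)) := by
      simp only [blockMin, hp]
    rw [Finset.mem_filter, this, Fin.val_inj, blockMin_eq_iff, hp, π.part_eq_iff_mem hB]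
    simp

theorem minLabels_injective :
    Function.Injective (minLabels : Finpartition (Finset.univ : Finset (Fin k)) → List ℕ) := by
  intro π π' h
  have h : blockMin π = blockMin π' := by
    have := List.ofFn_injective h
    funext i
    exact Fin.ext (congrFun this i)
  have hpart : ∀ i, π.part i = π'.part i := by
    intro i
    ext j
    rw [π.mem_part_iff_part_eq_part (Finset.mem_univ _) (Finset.mem_univ _),
      π'.mem_part_iff_part_eq_part (Finset.mem_univ _) (Finset.mem_univ _),
      ← blockMin_eq_iff, ← blockMin_eq_iff, h]
  have hparts : ∀ ρ : Finpartition (Finset.univ : Finset (Fin k)),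
      ρ.parts = Finset.univ.image ρ.part := by
    intro ρ
    ext B
    rw [Finset.mem_image]
    constructor
    · intro hB
      obtain ⟨i, hi⟩ := ρ.nonempty_of_mem_parts hB
      exact ⟨i, Finset.mem_univ i, ρ.part_eq_of_mem hB hi⟩
    · rintro ⟨i, -, rfl⟩
      exact ρ.part_mem.2 (Finset.mem_univ i)
  apply Finpartition.ext
  rw [hparts, hparts, funext hpart]

end BlockMin

theorem IsBracketing.exists_minLabels_eq {L : List ℕ} (h : IsBracketing 0 L) :
    ∃ π : Finpartition (Finset.univ : Finset (Fin L.length)), minLabels π = L := by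
  classical
  rw [isBracketing_iff] at h
  simp only [zero_add] at h
  let f : Fin L.length → ℕ := fun i => L[i]
  have hle : ∀ i, f i ≤ i := fun i => (h i i.2).1
  refine ⟨Finpartition.ofSetoid (Setoid.ker f), List.ext_getElem (by simp [minLabels]) ?_⟩
  intro i _ hi
  simp only [minLabels, List.getElem_ofFn]
  set π := Finpartition.ofSetoid (Setoid.ker f)
  have hmem : ∀ a b, b ∈ π.part a ↔ f a = f b := fun a b =>
    Finpartition.mem_part_ofSetoid_iff_rel
  apply le_antisymm
  · have hlt : f ⟨i, hi⟩ < L.length := (hle _).trans_lt hi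
    have : blockMin π ⟨i, hi⟩ ≤ ⟨f ⟨i, hi⟩, hlt⟩ := by
      refine blockMin_le_of_mem ((hmem _ _).2 (le_antisymm ?_ (hle ⟨f ⟨i, hi⟩, hlt⟩)))
      exact (h i hi).2 _ (h i hi).1 le_rfl
    exact this
  · have : f ⟨i, hi⟩ = f (blockMin π ⟨i, hi⟩) := (hmem _ _).1 (Finset.min'_mem _ _)
    exact this.trans_le (hle _)

theorem card_isNoncrossing_eq {k : ℕ} {M : Multiset ℕ} (h0 : 0 ∉ M) :
    Nat.card {π : Finpartition (Finset.univ : Finset (Fin k)) //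
      IsNoncrossing π ∧ Multiset.map Finset.card π.parts.val = M} = #(bracketings k 0 [] M) := by
  have hmem : ∀ L, L ∈ bracketings k 0 [] M ↔
      L.length = k ∧ IsBracketing 0 L ∧ openedCounts 0 L = M := by
    intro L
    rw [mem_bracketings h0 (by simp) List.Pairwise.nil]
    simp
  rw [← Fintype.card_coe, ← Nat.card_eq_fintype_card]
  refine Nat.card_congr (Equiv.ofBijective (fun π => ⟨minLabels π.1, (hmem _).2
    ⟨by simp [minLabels], isBracketing_minLabels_iff.2 π.2.1,
      openedCounts_minLabels.trans π.2.2⟩⟩) ⟨?_, ?_⟩)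
  · intro π π' h
    exact Subtype.ext (minLabels_injective (congrArg Subtype.val h))
  · rintro ⟨L, hL⟩
    obtain ⟨rfl, h1, h2⟩ := (hmem L).1 hL
    obtain ⟨π, hπ⟩ := h1.exists_minLabels_eq
    exact ⟨⟨π, isBracketing_minLabels_iff.1 (by rwa [hπ]),
      by rw [← openedCounts_minLabels, hπ, h2]⟩, Subtype.ext hπ⟩

theorem YoungDiagram.sum_rowLens (μ : YoungDiagram) : μ.rowLens.sum = μ.card := by
  have h : Set.MapsTo Prod.fst (μ.cells : Set (ℕ × ℕ)) (Finset.range (μ.colLen 0)) := by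
    intro c hc
    simp only [Finset.coe_range, Set.mem_Iio]
    exact μ.mem_iff_lt_colLen.1 (μ.up_left_mem le_rfl (Nat.zero_le _) hc)
  rw [YoungDiagram.card, Finset.card_eq_sum_card_fiberwise h, YoungDiagram.rowLens,
    ← List.sum_toFinset _ List.nodup_range]
  refine Finset.sum_congr (by ext; simp) fun i _ => ?_
  rw [YoungDiagram.rowLen_eq_card, YoungDiagram.row]

/-- Kreweras' formula: for a partition `σ ⊢ k` with multiplicities `m_j(σ)` and `l(σ)`
parts, the number of noncrossing partitions of `{1,…,k}` with block sizes `σ` equals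
`k! / ((k − l(σ) + 1)! ∏_j m_j(σ)!)`. -/
theorem kreweras_count (k : ℕ) (σ : YoungDiagram) (hσ : σ.card = k) :
    Nat.card {π : Finpartition (Finset.univ : Finset (Fin k)) //
        IsNoncrossing π ∧ Multiset.map Finset.card π.parts.val = (σ.rowLens : Multiset ℕ)} =
      k.factorial /
        ((k - σ.rowLens.length + 1).factorial *
          ∏ j ∈ Finset.Icc 1 k, (Multiset.count j (σ.rowLens : Multiset ℕ)).factorial) := by
  have hsum : σ.rowLens.sum = k := σ.sum_rowLens.trans hσ
  have h0 : 0 ∉ (σ.rowLens : Multiset ℕ) := fun h =>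
    (σ.pos_of_mem_rowLens 0 (Multiset.mem_coe.1 h)).false
  have hmem : ∀ x ∈ (σ.rowLens : Multiset ℕ), x ∈ Finset.Icc 1 k := by
    intro x hx
    rw [Multiset.mem_coe] at hx
    exact Finset.mem_Icc.2 ⟨σ.pos_of_mem_rowLens x hx, hsum ▸ List.le_sum_of_mem hx⟩
  have h := card_bracketings (n := 0) (st := []) hmem h0 (by simp) List.Pairwise.nil
    (by simpa using hsum)
  rw [card_isNoncrossing_eq h0]
  simp only [Multiset.coe_card, List.length_nil, zero_add, one_mul] at h
  refine (Nat.div_eq_of_eq_mul_left ?_ h.symm).symm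
  exact Nat.mul_pos (Nat.factorial_pos _) (Finset.prod_pos fun j _ => Nat.factorial_pos _)
end

section
/- Let T be a finite group and g = d·w, h = d'·w' ∈ S_n(T) = T^n ⋊ S_n with |supp(g) ∩ supp(h)| = r ≥ 1. Then |type(gh)| − l(type(gh)) ≥ (|type(g)| − l(type(g))) + (|type(h)| − l(type(h))) − 2r + 2. -/
/-- The action of `S_n` on `T^n` by permuting coordinates. -/
def permAct (T : Type*) [Group T] (n : ℕ) : Equiv.Perm (Fin n) →* MulAut (Fin n → T) where
  toFun σ :=
    { toFun := fun f => f ∘ σ.symm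
      invFun := fun f => f ∘ σ
      left_inv := fun f => by ext i; simp
      right_inv := fun f => by ext i; simp
      map_mul' := fun f g => rfl }
  map_one' := rfl
  map_mul' := fun σ τ => rfl

/-- The wreath product `S_n(T) = T^n ⋊ S_n`. -/
abbrev Wreath (T : Type*) [Group T] (n : ℕ) :=
  SemidirectProduct (Fin n → T) (Equiv.Perm (Fin n)) (permAct T n)

open Classical in
/-- The support of `g = (x_1,…,x_n)τ ∈ S_n(T)`:
`supp g = { j : τ(j) ≠ j or x_j ≠ e_T }`. -/
noncomputable def wSupp {T : Type*} [Group T] {n : ℕ} (g : Wreath T n) : Finset (Fin n) :=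
  g.right.support ∪ Finset.univ.filter (fun j => g.left j ≠ 1)

/-- `|type(g)| − l(type(g))` for `g ∈ S_n(T)`: each cycle of the colored type
contributes its length minus one, so this quantity is unaffected by the `T^n`-component
and equals the corresponding quantity for the `S_n`-part of `g`. -/
def wLen {T : Type*} [Group T] {n : ℕ} (g : Wreath T n) : ℕ :=
  g.right.cycleType.sum - g.right.cycleType.card

/-- The length of a permutation: the sum over its cycles of their lengths minus one. -/
def permLen {α : Type*} [Fintype α] [DecidableEq α] (σ : Equiv.Perm α) : ℕ :=
  σ.cycleType.sum - σ.cycleType.card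

/-- The linear map `f ↦ f ∘ σ - f` on rational functions. -/
def permDiff {α : Type*} (σ : Equiv.Perm α) : (α → ℚ) →ₗ[ℚ] (α → ℚ) :=
  LinearMap.funLeft ℚ ℚ σ - LinearMap.id

/-- The functions supported on `I` whose values sum to zero. -/
def sumZeroOn {α : Type*} [Fintype α] (I : Finset α) : Submodule ℚ (α → ℚ) where
  carrier := {g | (∀ i ∉ I, g i = 0) ∧ ∑ i, g i = 0}
  add_mem' := fun ha hb => ⟨fun i hi => by simp [ha.1 i hi, hb.1 i hi],
    by simp [Finset.sum_add_distrib, ha.2, hb.2]⟩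
  zero_mem' := by simp
  smul_mem' := fun c g hg => ⟨fun i hi => by simp [hg.1 i hi],
    by simp [← Finset.mul_sum, hg.2]⟩

theorem mem_ker_permDiff {α : Type*} {σ : Equiv.Perm α} {f : α → ℚ} :
    f ∈ LinearMap.ker (permDiff σ) ↔ ∀ i, f (σ i) = f i := by
  simp [permDiff, funext_iff, LinearMap.funLeft_apply, sub_eq_zero]

theorem permDiff_mem_sumZeroOn {α : Type*} [Fintype α] {σ τ : Equiv.Perm α}
    {I : Finset α} (hI : ∀ i ∉ I, σ i = i ∨ τ i = i) {f : α → ℚ}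
    (hf : f ∈ LinearMap.ker (permDiff (σ * τ))) :
    permDiff σ f ∈ sumZeroOn I := by
  rw [mem_ker_permDiff] at hf
  refine ⟨fun i hi => ?_, ?_⟩
  · change f (σ i) - f i = 0
    rcases hI i hi with h | h
    · rw [h, sub_self]
    · have := hf i
      rw [Equiv.Perm.mul_apply, h] at this
      rw [this, sub_self]
  · change ∑ i, (f (σ i) - f i) = 0
    rw [Finset.sum_sub_distrib, Equiv.sum_comp σ f, sub_self]

theorem finrank_ker_permDiff_mul_le {α : Type*} [Fintype α] {σ τ : Equiv.Perm α}
    {I : Finset α} (hI : ∀ i ∉ I, σ i = i ∨ τ i = i) :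
    Module.finrank ℚ (LinearMap.ker (permDiff (σ * τ))) ≤ Module.finrank ℚ (sumZeroOn I) +
      Module.finrank ℚ
        (LinearMap.ker (permDiff σ) ⊓ LinearMap.ker (permDiff τ) : Submodule ℚ (α → ℚ)) := by
  set F := LinearMap.ker (permDiff (σ * τ))
  rw [← LinearMap.finrank_range_add_finrank_ker (permDiff σ ∘ₗ F.subtype),
    ← Submodule.finrank_map_subtype_eq F (LinearMap.ker _)]
  refine add_le_add (Submodule.finrank_mono ?_) (Submodule.finrank_mono ?_)
  · rintro _ ⟨⟨f, hf⟩, rfl⟩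
    exact permDiff_mem_sumZeroOn hI hf
  · rintro _ ⟨⟨f, hf⟩, hker, rfl⟩
    have hσ : ∀ i, f (σ i) = f i := mem_ker_permDiff.1 hker
    refine ⟨mem_ker_permDiff.2 hσ, mem_ker_permDiff.2 fun i => ?_⟩
    exact (hσ _).symm.trans (mem_ker_permDiff.1 hf i)

section

variable {α : Type*} [Fintype α] [DecidableEq α]

theorem apply_eq_of_sameCycle {β : Type*} {σ : Equiv.Perm α} {f : α → β}
    (hf : ∀ i, f (σ i) = f i) {x y : α} (h : σ.SameCycle x y) : f x = f y := by
  obtain ⟨k, -, -, rfl⟩ := h.exists_pow_eq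
  clear h
  induction k with
  | zero => rfl
  | succ k ih => rw [pow_succ', Equiv.Perm.mul_apply, hf, ih]

/-- The cycle containing a point: a cycle factor, or the point itself if it is fixed. -/
def cycleIndex (σ : Equiv.Perm α) (x : α) :
    σ.cycleFactorsFinset ⊕ {x // x ∈ σ.supportᶜ} :=
  if h : x ∈ σ.support then
    .inl ⟨σ.cycleOf x, Equiv.Perm.cycleOf_mem_cycleFactorsFinset_iff.2 h⟩
  else .inr ⟨x, Finset.mem_compl.2 h⟩

theorem cycleIndex_eq_iff {σ : Equiv.Perm α} {x y : α} :
    cycleIndex σ x = cycleIndex σ y ↔ σ.SameCycle x y := by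
  by_cases hx : x ∈ σ.support <;> by_cases hy : y ∈ σ.support
  · simp only [cycleIndex, hx, hy, dite_true, Sum.inl.injEq, Subtype.mk.injEq]
    exact (Equiv.Perm.sameCycle_iff_cycleOf_eq_of_mem_support hx hy).symm
  · simp only [cycleIndex, hx, hy, dite_true, dite_false, reduceCtorEq, false_iff]
    exact fun h => hy (h.mem_support_iff.1 hx)
  · simp only [cycleIndex, hx, hy, dite_true, dite_false, reduceCtorEq, false_iff]
    exact fun h => hx (h.mem_support_iff.2 hy)
  · simp only [cycleIndex, hx, hy, dite_false, Sum.inr.injEq, Subtype.mk.injEq]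
    refine ⟨fun h => h ▸ Equiv.Perm.SameCycle.refl _ _, fun h => ?_⟩
    exact (h.eq_of_left (Equiv.Perm.notMem_support.1 hx))

theorem cycleIndex_surjective (σ : Equiv.Perm α) : Function.Surjective (cycleIndex σ) := by
  rintro (⟨c, hc⟩ | ⟨x, hx⟩)
  · obtain ⟨x, hx⟩ := (Equiv.Perm.mem_cycleFactorsFinset_iff.1 hc).1.nonempty_support
    have hxσ : x ∈ σ.support := Equiv.Perm.mem_cycleFactorsFinset_support_le hc hx
    exact ⟨x, by simp [cycleIndex, hxσ, Equiv.Perm.cycle_is_cycleOf hx hc]⟩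
  · exact ⟨x, by simp [cycleIndex, Finset.mem_compl.1 hx]⟩

theorem range_funLeft_cycleIndex (σ : Equiv.Perm α) :
    LinearMap.range (LinearMap.funLeft ℚ ℚ (cycleIndex σ)) = LinearMap.ker (permDiff σ) := by
  ext f
  rw [mem_ker_permDiff]
  constructor
  · rintro ⟨g, rfl⟩ i
    exact congrArg g (cycleIndex_eq_iff.2 (Equiv.Perm.sameCycle_apply_left.2 (.refl _ _)))
  · intro hf
    refine ⟨fun s => f (Function.surjInv (cycleIndex_surjective σ) s), funext fun x => ?_⟩
    exact apply_eq_of_sameCycle hf (cycleIndex_eq_iff.1 (Function.surjInv_eq _ _))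

theorem finrank_ker_permDiff_add_permLen (σ : Equiv.Perm α) :
    Module.finrank ℚ (LinearMap.ker (permDiff σ)) + permLen σ = Fintype.card α := by
  rw [← range_funLeft_cycleIndex, LinearMap.finrank_range_of_inj
    (LinearMap.funLeft_injective_of_surjective _ _ _ (cycleIndex_surjective σ)),
    Module.finrank_fintype_fun_eq_card, Fintype.card_sum, Fintype.card_coe, Fintype.card_coe,
    Finset.card_compl, permLen, σ.sum_cycleType]
  have hcard : σ.cycleType.card = σ.cycleFactorsFinset.card := by
    rw [Equiv.Perm.cycleType_def, Multiset.card_map, Finset.card_val]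
  have hle : σ.cycleType.card • 1 ≤ σ.cycleType.sum :=
    Multiset.card_nsmul_le_sum fun k hk => (Equiv.Perm.one_lt_of_mem_cycleType hk).le
  rw [σ.sum_cycleType, hcard] at hle
  have := σ.support.card_le_univ
  simp only [smul_eq_mul] at hle
  omega

theorem finrank_sumZeroOn_add_one_le {I : Finset α} (hI : I.Nonempty) :
    Module.finrank ℚ (sumZeroOn I) + 1 ≤ I.card := by
  obtain ⟨x, hx⟩ := hI
  have hinj : Function.Injective
      (LinearMap.funLeft ℚ ℚ (Subtype.val : I.erase x → α) ∘ₗ (sumZeroOn I).subtype) := by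
    rw [← LinearMap.ker_eq_bot, LinearMap.ker_eq_bot']
    rintro ⟨g, hg, hsum⟩ h
    have hne : ∀ i ≠ x, g i = 0 := fun i hi => by
      by_cases hiI : i ∈ I
      · exact congrFun h ⟨i, Finset.mem_erase.2 ⟨hi, hiI⟩⟩
      · exact hg i hiI
    have hgx : g x = 0 := by
      rwa [Finset.sum_eq_single x (fun i _ hi => hne i hi) (by simp)] at hsum
    ext i
    by_cases hi : i = x
    · simpa [hi] using hgx
    · simpa using hne i hi
  have h := LinearMap.finrank_le_finrank_of_injective hinj
  rw [Module.finrank_fintype_fun_eq_card, Fintype.card_coe, Finset.card_erase_of_mem hx] at h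
  have := Finset.card_pos.2 ⟨x, hx⟩
  omega

theorem ker_permDiff_sup_sumZeroOn {σ τ : Equiv.Perm α} {I : Finset α} (hne : I.Nonempty)
    (hI : ∀ i ∉ I, σ i = i ∨ τ i = i) :
    (LinearMap.ker (permDiff σ) ⊔ LinearMap.ker (permDiff τ)) ⊔ sumZeroOn I = ⊤ := by
  set S := LinearMap.ker (permDiff σ) ⊔ LinearMap.ker (permDiff τ)
  have hfix (ρ : Equiv.Perm α) {i : α} (h : ρ i = i) (c : ℚ) :
      Pi.single i c ∈ LinearMap.ker (permDiff ρ) := by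
    refine mem_ker_permDiff.2 fun j => ?_
    have : ρ j = i ↔ j = i := by rw [← h, ρ.injective.eq_iff, h]
    simp [Pi.single_apply, this]
  have hsingle : ∀ i ∉ I, ∀ c : ℚ, Pi.single i c ∈ S := fun i hi c =>
    (hI i hi).elim (fun h => le_sup_left (α := Submodule ℚ (α → ℚ)) (hfix σ h c))
      fun h => le_sup_right (α := Submodule ℚ (α → ℚ)) (hfix τ h c)
  have hconst (c : ℚ) : (fun _ => c) ∈ S :=
    le_sup_left (α := Submodule ℚ (α → ℚ)) (mem_ker_permDiff.2 fun _ => rfl)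
  rw [eq_top_iff]
  intro f _
  set c : ℚ := (∑ i ∈ I, f i) / I.card with hc
  have hcard : (I.card : ℚ) ≠ 0 := by exact_mod_cast hne.card_pos.ne'
  have hoff : ∑ i ∈ Iᶜ, Pi.single i (f i - c) ∈ S :=
    Submodule.sum_mem _ fun i hi => hsingle i (Finset.mem_compl.1 hi) _
  have hon : (fun i => if i ∈ I then f i - c else 0) ∈ sumZeroOn I := by
    refine ⟨fun i hi => if_neg hi, ?_⟩
    rw [← Finset.sum_filter, Finset.filter_mem_eq_inter, Finset.univ_inter,
      Finset.sum_sub_distrib, Finset.sum_const, nsmul_eq_mul, hc]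
    field_simp
    ring
  convert! Submodule.add_mem_sup (S.add_mem hoff (hconst c)) hon using 1
  ext i
  by_cases hi : i ∈ I <;> simp [Finset.sum_apply, Pi.single_apply, hi]

theorem permLen_add_le {σ τ : Equiv.Perm α} {I : Finset α} (hne : I.Nonempty)
    (hI : ∀ i ∉ I, σ i = i ∨ τ i = i) :
    permLen σ + permLen τ + 2 ≤ permLen (σ * τ) + 2 * I.card := by
  have hmul := finrank_ker_permDiff_mul_le hI
  have hsup := Submodule.finrank_sup_add_finrank_inf_eq
    (LinearMap.ker (permDiff σ)) (LinearMap.ker (permDiff τ))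
  have htop := Submodule.finrank_add_le_finrank_add_finrank
    (LinearMap.ker (permDiff σ) ⊔ LinearMap.ker (permDiff τ)) (sumZeroOn I)
  rw [ker_permDiff_sup_sumZeroOn hne hI, finrank_top, Module.finrank_fintype_fun_eq_card] at htop
  have hZ := finrank_sumZeroOn_add_one_le hne
  have hσ := finrank_ker_permDiff_add_permLen σ
  have hτ := finrank_ker_permDiff_add_permLen τ
  have hστ := finrank_ker_permDiff_add_permLen (σ * τ)
  omega

end

/-- For `g, h ∈ S_n(T)` with `|supp g ∩ supp h| = r ≥ 1`,
`|type(gh)| − l(type(gh)) ≥ (|type(g)| − l(type(g))) + (|type(h)| − l(type(h))) − 2r + 2`. -/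
theorem wLen_mul_ge {T : Type*} [Group T] {n : ℕ} (g h : Wreath T n) (r : ℕ)
    (hr : (wSupp g ∩ wSupp h).card = r) (hr1 : 1 ≤ r) :
    (wLen (g * h) : ℤ) ≥ (wLen g : ℤ) + wLen h - 2 * r + 2 := by
  have hI : ∀ i ∉ wSupp g ∩ wSupp h, g.right i = i ∨ h.right i = i := fun i hi => by
    by_contra! hne
    exact hi (Finset.mem_inter.2 ⟨Finset.mem_union_left _ (Equiv.Perm.mem_support.2 hne.1),
      Finset.mem_union_left _ (Equiv.Perm.mem_support.2 hne.2)⟩)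
  have key := permLen_add_le (Finset.card_pos.1 (by omega)) hI
  change (permLen (g.right * h.right) : ℤ) ≥ permLen g.right + permLen h.right - 2 * r + 2
  omega
end

section
/- Let {M_k}_{k≥0} be the moment sequence of a probability measure m on ℝ with all moments finite. If sup_{k≥2} |M_k|^{1/k}/k < ∞, then Σ_{k=1}^∞ M_{2k}^{−1/(2k)} = ∞ (Carleman's condition), and hence m is the unique probability measure with these moments. -/
open MeasureTheory

open ProbabilityTheory Filter Topology

theorem integrable_cosh_mul_of_summable {μ : Measure ℝ} {t : ℝ}
    (hint : ∀ k : ℕ, Integrable (fun x => x ^ (2 * k)) μ)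
    (hsum : Summable fun k : ℕ => t ^ (2 * k) / (2 * k).factorial * ∫ x, x ^ (2 * k) ∂μ) :
    Integrable (fun x => Real.cosh (t * x)) μ := by
  have hterm (k : ℕ) (x : ℝ) : 0 ≤ t ^ (2 * k) / (2 * k).factorial * x ^ (2 * k) := by
    have h₁ : 0 ≤ t ^ (2 * k) := (even_two_mul k).pow_nonneg t
    have h₂ : 0 ≤ x ^ (2 * k) := (even_two_mul k).pow_nonneg x
    positivity
  have hcosh (x : ℝ) : HasSum (fun k : ℕ => t ^ (2 * k) / (2 * k).factorial * x ^ (2 * k))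
      (Real.cosh (t * x)) := by
    convert! Real.hasSum_cosh (t * x) using 2 with k
    rw [mul_pow]
    ring
  refine ⟨by fun_prop, ?_⟩
  rw [hasFiniteIntegral_iff_ofReal (Eventually.of_forall fun x => (Real.cosh_pos _).le)]
  have hseries (x : ℝ) : ENNReal.ofReal (Real.cosh (t * x)) =
      ∑' k : ℕ, ENNReal.ofReal (t ^ (2 * k) / (2 * k).factorial * x ^ (2 * k)) := by
    rw [← (hcosh x).tsum_eq, ENNReal.ofReal_tsum_of_nonneg (hterm · x) (hcosh x).summable]
  simp_rw [hseries]
  rw [lintegral_tsum fun k => by fun_prop]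
  have hlint (k : ℕ) :
      ∫⁻ x, ENNReal.ofReal (t ^ (2 * k) / (2 * k).factorial * x ^ (2 * k)) ∂μ =
        ENNReal.ofReal (t ^ (2 * k) / (2 * k).factorial * ∫ x, x ^ (2 * k) ∂μ) := by
    rw [← integral_const_mul, ofReal_integral_eq_lintegral_ofReal ((hint k).const_mul _)
      (Eventually.of_forall (hterm k))]
  simp_rw [hlint]
  rw [← ENNReal.ofReal_tsum_of_nonneg (fun k => ?_) hsum]
  · exact ENNReal.ofReal_lt_top
  · rw [← integral_const_mul]
    exact integral_nonneg (hterm k)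

theorem mem_integrableExpSet_id_of_moment_le {μ : Measure ℝ} {C t : ℝ} (hC : 0 ≤ C)
    (hint : ∀ k : ℕ, Integrable (fun x => x ^ (2 * k)) μ)
    (hle : ∀ k : ℕ, ∫ x, x ^ (2 * k) ∂μ ≤ (C * (2 * k : ℕ)) ^ (2 * k))
    (ht : |t| * C * Real.exp 1 < 1) : t ∈ integrableExpSet id μ := by
  have hr : 0 ≤ |t| * C * Real.exp 1 := by positivity
  have hsum : Summable fun k : ℕ => t ^ (2 * k) / (2 * k).factorial * ∫ x, x ^ (2 * k) ∂μ := by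
    refine Summable.of_nonneg_of_le (fun k => ?_) (fun k => ?_)
      (summable_geometric_of_lt_one (sq_nonneg (|t| * C * Real.exp 1))
        (pow_lt_one₀ hr ht two_ne_zero))
    · have h₁ : 0 ≤ t ^ (2 * k) := (even_two_mul k).pow_nonneg t
      have h₂ : 0 ≤ ∫ x, x ^ (2 * k) ∂μ :=
        integral_nonneg fun x => (even_two_mul k).pow_nonneg x
      positivity
    · rw [← (even_two_mul k).pow_abs t, ← pow_mul]
      have hfac := Real.pow_div_factorial_le_exp (x := (2 * k : ℕ)) (by positivity) (2 * k)
      calc |t| ^ (2 * k) / (2 * k).factorial * ∫ x, x ^ (2 * k) ∂μ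
          ≤ |t| ^ (2 * k) / (2 * k).factorial * (C * (2 * k : ℕ)) ^ (2 * k) := by
            gcongr
            exact hle k
        _ = (|t| * C) ^ (2 * k) * (((2 * k : ℕ) : ℝ) ^ (2 * k) / (2 * k).factorial) := by
            rw [mul_pow, mul_pow]
            ring
        _ ≤ (|t| * C) ^ (2 * k) * Real.exp (2 * k : ℕ) := by gcongr
        _ = (|t| * C * Real.exp 1) ^ (2 * k) := by
            rw [mul_pow _ (Real.exp 1), Real.exp_one_pow]
  refine ((integrable_cosh_mul_of_summable hint hsum).const_mul 2).mono' (by fun_prop)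
    (Eventually.of_forall fun x => ?_)
  rw [Real.norm_of_nonneg (Real.exp_pos _).le, Real.cosh_eq, id]
  linarith [Real.exp_pos (-(t * x))]

theorem AnalyticAt.eventuallyEq_of_iteratedDeriv_eq {f g : ℂ → ℂ} {z : ℂ}
    (hf : AnalyticAt ℂ f z) (hg : AnalyticAt ℂ g z)
    (h : ∀ n, iteratedDeriv n f z = iteratedDeriv n g z) : f =ᶠ[𝓝 z] g := by
  have hf' := hf.hasFPowerSeriesAt
  simp_rw [h] at hf'
  filter_upwards [hf'.eventually_hasSum_sub, hg.hasFPowerSeriesAt.eventually_hasSum_sub]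
    with y hy₁ hy₂
  exact hy₁.unique hy₂

/-- Two finite measures on `ℝ` with finite exponential moments near `0` and the same moments
are equal. -/
theorem ext_of_moments_of_integrableExpSet {μ ν : Measure ℝ} [IsFiniteMeasure μ]
    [IsFiniteMeasure ν] (hμ : integrableExpSet id μ ∈ 𝓝 0) (hν : integrableExpSet id ν ∈ 𝓝 0)
    (h : ∀ k : ℕ, ∫ x, x ^ k ∂μ = ∫ x, x ^ k ∂ν) : μ = ν := by
  set S : Set ℝ := interior (integrableExpSet id μ) ∩ interior (integrableExpSet id ν)
  have h0 : (0 : ℝ) ∈ S := ⟨mem_interior_iff_mem_nhds.2 hμ, mem_interior_iff_mem_nhds.2 hν⟩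
  have hSconv : Convex ℝ (Complex.re ⁻¹' S) :=
    (convex_integrableExpSet.interior.inter convex_integrableExpSet.interior).linear_preimage
      Complex.reLm
  have hfμ : AnalyticOnNhd ℂ (complexMGF id μ) (Complex.re ⁻¹' S) :=
    analyticOnNhd_complexMGF.mono fun z hz => hz.1
  have hfν : AnalyticOnNhd ℂ (complexMGF id ν) (Complex.re ⁻¹' S) :=
    analyticOnNhd_complexMGF.mono fun z hz => hz.2
  have h0' : (0 : ℂ) ∈ Complex.re ⁻¹' S := by simpa using h0
  have heq : complexMGF id μ =ᶠ[𝓝 0] complexMGF id ν := by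
    refine (hfμ 0 h0').eventuallyEq_of_iteratedDeriv_eq (hfν 0 h0') fun n => ?_
    rw [iteratedDeriv_complexMGF h0'.1, iteratedDeriv_complexMGF h0'.2]
    simp only [id, zero_mul, Complex.exp_zero, mul_one]
    exact_mod_cast congrArg ((↑) : ℝ → ℂ) (h n)
  have hEqOn := hfμ.eqOn_of_preconnected_of_eventuallyEq hfν hSconv.isPreconnected h0' heq
  refine Measure.ext_of_charFun (funext fun t => ?_)
  rw [← complexMGF_id_mul_I, ← complexMGF_id_mul_I]
  exact hEqOn (by simpa using h0)

theorem ext_of_moments_of_moment_le {μ ν : Measure ℝ} [IsFiniteMeasure μ] [IsFiniteMeasure ν]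
    {C : ℝ} (hC : 0 < C) (hμ : ∀ k : ℕ, Integrable (fun x => x ^ k) μ)
    (hν : ∀ k : ℕ, Integrable (fun x => x ^ k) ν)
    (hle : ∀ k : ℕ, ∫ x, x ^ (2 * k) ∂μ ≤ (C * (2 * k : ℕ)) ^ (2 * k))
    (h : ∀ k : ℕ, ∫ x, x ^ k ∂μ = ∫ x, x ^ k ∂ν) : μ = ν := by
  have hsmall : ∀ᶠ t : ℝ in 𝓝 0, |t| * C * Real.exp 1 < 1 :=
    ContinuousAt.eventually_lt (by fun_prop) continuousAt_const (by simp)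
  refine ext_of_moments_of_integrableExpSet ?_ ?_ h
  · filter_upwards [hsmall] with t ht
    exact mem_integrableExpSet_id_of_moment_le hC.le (fun k => hμ _) hle ht
  · filter_upwards [hsmall] with t ht
    exact mem_integrableExpSet_id_of_moment_le hC.le (fun k => hν _)
      (fun k => (h _).symm.trans_le (hle k)) ht

theorem tsum_ofReal_rpow_neg_eq_top {a : ℕ → ℝ} {C : ℝ} (hC : 0 < C)
    (hle : ∀ k : ℕ, a k ≤ (C * (2 * k : ℕ)) ^ (2 * k)) :
    ∑' k : ℕ, ENNReal.ofReal (a (k + 1)) ^ (-(1 : ℝ) / (2 * (k + 1))) = ⊤ := by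
  have hterm (k : ℕ) : ENNReal.ofReal ((2 * C)⁻¹ * (1 / ((k : ℝ) + 1))) ≤
      ENNReal.ofReal (a (k + 1)) ^ (-(1 : ℝ) / (2 * (k + 1))) := by
    have hpos : 0 < C * (2 * (k + 1) : ℕ) := by positivity
    calc ENNReal.ofReal ((2 * C)⁻¹ * (1 / ((k : ℝ) + 1)))
        = (ENNReal.ofReal (C * (2 * (k + 1) : ℕ)))⁻¹ := by
          rw [← ENNReal.ofReal_inv_of_pos hpos]
          congr 1
          push_cast
          field_simp
      _ = (ENNReal.ofReal ((C * (2 * (k + 1) : ℕ)) ^ (2 * (k + 1)))) ^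
            (-(1 : ℝ) / (2 * (k + 1))) := by
          rw [ENNReal.ofReal_pow hpos.le, ← ENNReal.rpow_natCast, ← ENNReal.rpow_mul,
            ← ENNReal.rpow_neg_one]
          congr 1
          push_cast
          field_simp
      _ ≤ _ := by
          rw [neg_div, ENNReal.rpow_neg, ENNReal.rpow_neg]
          gcongr
          exact hle (k + 1)
  refine top_unique (le_trans (le_of_eq ?_) (ENNReal.tsum_le_tsum hterm))
  by_contra hne
  have hs := ENNReal.summable_toReal (Ne.symm hne)
  have hs' : Summable fun k : ℕ => (2 * C)⁻¹ * (1 / ((k : ℝ) + 1)) :=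
    hs.congr fun k => ENNReal.toReal_ofReal (by positivity)
  rw [summable_mul_left_iff (by positivity)] at hs'
  exact Real.not_summable_one_div_natCast ((summable_nat_add_iff 1).1 (by exact_mod_cast hs'))

theorem exists_moment_le_of_growth {M : ℕ → ℝ} (h0 : M 0 ≤ 1)
    (hgrowth : ∃ C : ℝ, ∀ k : ℕ, 2 ≤ k → |M k| ^ ((1 : ℝ) / k) / k ≤ C) :
    ∃ C : ℝ, 0 < C ∧ ∀ k : ℕ, M (2 * k) ≤ (C * (2 * k : ℕ)) ^ (2 * k) := by
  obtain ⟨C, hC⟩ := hgrowth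
  refine ⟨max C 1, by positivity, fun k => ?_⟩
  obtain rfl | hk := k.eq_zero_or_pos
  · simpa using h0
  have hn : 0 < 2 * k := by positivity
  have hroot : |M (2 * k)| ^ ((1 : ℝ) / (2 * k : ℕ)) ≤ max C 1 * (2 * k : ℕ) :=
    (div_le_iff₀ (by positivity)).1 ((hC (2 * k) (by omega)).trans (le_max_left _ _))
  calc M (2 * k) ≤ |M (2 * k)| := le_abs_self _
    _ = (|M (2 * k)| ^ ((1 : ℝ) / (2 * k : ℕ))) ^ (2 * k) := by
        rw [one_div, Real.rpow_inv_natCast_pow (abs_nonneg _) hn.ne']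
    _ ≤ _ := by gcongr

/-- If the moment sequence `{M_k}` of a probability measure `m` on `ℝ` satisfies
`sup_{k≥2} |M_k|^{1/k}/k < ∞`, then Carleman's condition `Σ_{k≥1} M_{2k}^{−1/(2k)} = ∞`
holds, and `m` is the unique probability measure (with all moments) having these
moments. -/
theorem carleman_of_moment_growth (m : Measure ℝ) [IsProbabilityMeasure m]
    (M : ℕ → ℝ)
    (hint : ∀ k : ℕ, Integrable (fun x => x ^ k) m)
    (hM : ∀ k : ℕ, M k = ∫ x, x ^ k ∂m)
    (hgrowth : ∃ C : ℝ, ∀ k : ℕ, 2 ≤ k → |M k| ^ ((1 : ℝ) / k) / k ≤ C) :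
    (∑' k : ℕ, (ENNReal.ofReal (M (2 * (k + 1)))) ^ (-(1 : ℝ) / (2 * (k + 1))) = ⊤) ∧
    ∀ m' : Measure ℝ, IsProbabilityMeasure m' →
      (∀ k : ℕ, Integrable (fun x => x ^ k) m') →
      (∀ k : ℕ, (∫ x, x ^ k ∂m') = M k) → m' = m := by
  obtain ⟨C, hC, hle⟩ := exists_moment_le_of_growth (by simp [hM]) hgrowth
  refine ⟨tsum_ofReal_rpow_neg_eq_top (a := fun k => M (2 * k)) hC hle,
    fun m' _ hint' hM' => ?_⟩
  exact ext_of_moments_of_moment_le hC hint' hint (fun k => (hM' _).trans_le (hle k))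
    fun k => (hM' k).trans (hM k)
end

section
/- Let T be a finite group and let P = (P_{λμ}) be the matrix on 𝕐_n(T̂) defined by P_{λμ} = Σ_{ν: ν↗λ, ν↗μ} (dim ζ_{νλ})(dim ζ_{νμ}) · dim μ / (n|T| dim λ), the sum over ν ∈ 𝕐_{n−1}(T̂) with ν ↗ λ and ν ↗ μ. Then P is a stochastic matrix (rows sum to 1) and it is reversible with respect to the Plancherel measure M_Pl(λ) = (dim λ)^2/(n!|T|^n), i.e. M_Pl(λ)P_{λμ} = M_Pl(μ)P_{μλ} for all λ, μ ∈ 𝕐_n(T̂). -/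
open Finset Classical

/-- `dim λ`: the number of standard Young tableaux of shape `λ`. -/
noncomputable def dimYD (ν : YoungDiagram) : ℕ :=
  Nat.card {T : ν.cells ≃ Fin ν.card //
    ∀ c d : ν.cells, c.1.1 ≤ d.1.1 → c.1.2 ≤ d.1.2 → c ≠ d → T c < T d}

/-- `ν ↗ λ` at entry `i`: the tuple `λ` of Young diagrams is obtained from `ν` by adding
one box at the entry `i` (so `ζ_{νλ} = i`). -/
def AddBoxAt {ι : Type*} (ν lam : ι → YoungDiagram) (i : ι) : Prop :=
  (∀ i', i' ≠ i → ν i' = lam i') ∧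
    (ν i).cells ⊆ (lam i).cells ∧ (lam i).card = (ν i).card + 1

/-- The dimension of the irreducible representation of the wreath product `S_n(T)`
labeled by the tuple `λ ∈ 𝕐_n(T̂)`, where `d ζ` is the dimension of the irreducible
representation `ζ` of `T`:
`dim λ = ( n! / ∏_ζ |λ^ζ|! ) ∏_ζ (dim ζ)^{|λ^ζ|} ∏_ζ dim λ^ζ`. -/
noncomputable def DimW {ι : Type*} [Fintype ι] (d : ι → ℕ) (lam : ι → YoungDiagram) : ℕ :=
  Nat.multinomial Finset.univ (fun i => (lam i).card) *
    (∏ i, d i ^ (lam i).card) * ∏ i, dimYD (lam i)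

/-- The Res–Ind transition matrix
`P_{λμ} = Σ_{ν: ν↗λ, ν↗μ} (dim ζ_{νλ})(dim ζ_{νμ}) dim μ / (n |T| dim λ)`,
where `|T| = Σ_ζ (dim ζ)²`. -/
noncomputable def Pmat {ι : Type*} [Fintype ι] (d : ι → ℕ) (n : ℕ)
    (lam mu : ι → YoungDiagram) : ℝ :=
  (∑ᶠ ν : ι → YoungDiagram, ∑ i : ι, ∑ j : ι,
      if AddBoxAt ν lam i ∧ AddBoxAt ν mu j then (d i * d j : ℝ) else 0) *
    DimW d mu / (n * (∑ i, (d i) ^ 2) * DimW d lam)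

/-- The Plancherel measure `M_Pl(λ) = (dim λ)²/(n! |T|^n)`. -/
noncomputable def MPl {ι : Type*} [Fintype ι] (d : ι → ℕ) (n : ℕ)
    (lam : ι → YoungDiagram) : ℝ :=
  (DimW d lam : ℝ) ^ 2 / (n.factorial * (∑ i, (d i) ^ 2) ^ n)

namespace YoungDiagram

theorem finite_setOf_card_le (n : ℕ) : {μ : YoungDiagram | μ.card ≤ n}.Finite := by
  refine Set.Finite.of_finite_image (f := cells)
    ((Finset.finite_toSet (range n ×ˢ range n).powerset).subset ?_)
    (fun μ _ ν _ h => YoungDiagram.ext h)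
  rintro _ ⟨μ, hμ, rfl⟩
  simp only [coe_powerset, Set.mem_preimage, Set.mem_powerset_iff, Finset.coe_subset]
  rintro ⟨i, j⟩ h
  have h : (i, j) ∈ μ := h
  have hi : (range (i + 1)).image (fun k => (k, 0)) ⊆ μ.cells := by
    intro c hc
    obtain ⟨k, hk, rfl⟩ := Finset.mem_image.1 hc
    exact μ.up_left_mem (by simpa [Nat.lt_succ_iff] using hk) (Nat.zero_le _) h
  have hj : (range (j + 1)).image (fun k => (0, k)) ⊆ μ.cells := by
    intro c hc
    obtain ⟨k, hk, rfl⟩ := Finset.mem_image.1 hc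
    exact μ.up_left_mem (Nat.zero_le _) (by simpa [Nat.lt_succ_iff] using hk) h
  have hi' := Finset.card_le_card hi
  have hj' := Finset.card_le_card hj
  rw [Finset.card_image_of_injective _ (fun a b h => by simpa using h), card_range] at hi' hj'
  simp only [mem_product, Finset.mem_range]
  have : μ.cells.card ≤ n := hμ
  omega

/-- The Young diagrams with `n` boxes. -/
noncomputable def ofCard (n : ℕ) : Finset YoungDiagram :=
  {μ ∈ (finite_setOf_card_le n).toFinset | μ.card = n}

@[simp]
theorem mem_ofCard {n : ℕ} {μ : YoungDiagram} : μ ∈ ofCard n ↔ μ.card = n := by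
  simp only [ofCard, Finset.mem_filter, Set.Finite.mem_toFinset, Set.mem_ofPred_eq]
  omega

/-- The Young diagrams obtained from `ν` by adding a box. -/
noncomputable def upper (ν : YoungDiagram) : Finset YoungDiagram :=
  {μ ∈ ofCard (ν.card + 1) | ν ≤ μ}

/-- The Young diagrams obtained from `μ` by removing a box. -/
noncomputable def lower (μ : YoungDiagram) : Finset YoungDiagram :=
  {ν ∈ (finite_setOf_card_le μ.card).toFinset | ν ≤ μ ∧ μ.card = ν.card + 1}

theorem mem_upper {ν μ : YoungDiagram} : μ ∈ ν.upper ↔ ν ≤ μ ∧ μ.card = ν.card + 1 := by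
  simp [upper, and_comm]

theorem mem_lower {ν μ : YoungDiagram} : ν ∈ μ.lower ↔ ν ≤ μ ∧ μ.card = ν.card + 1 := by
  simp only [lower, Finset.mem_filter, Set.Finite.mem_toFinset, Set.mem_ofPred_eq]
  exact and_iff_right_of_imp fun h => by omega

theorem mem_lower_iff_mem_upper {ν μ : YoungDiagram} : ν ∈ μ.lower ↔ μ ∈ ν.upper := by
  rw [mem_lower, mem_upper]

theorem card_mono {ν μ : YoungDiagram} (h : ν ≤ μ) : ν.card ≤ μ.card :=
  Finset.card_le_card h

theorem eq_of_le_of_card_le {ν μ : YoungDiagram} (h : ν ≤ μ) (hc : μ.card ≤ ν.card) : ν = μ :=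
  YoungDiagram.ext (Finset.eq_of_subset_of_card_le h hc)

theorem card_sup_add_card_inf (ν μ : YoungDiagram) :
    (ν ⊔ μ).card + (ν ⊓ μ).card = ν.card + μ.card := by
  simpa [YoungDiagram.card] using Finset.card_union_add_card_inter ν.cells μ.cells

/-- The fillings of `μ` by `0, …, |μ| - 1`, increasing along rows and columns, extended by zero
outside `μ`. -/
def fillings (μ : YoungDiagram) : Set (ℕ × ℕ → ℕ) :=
  {f | (∀ c ∉ μ, f c = 0) ∧ (∀ c ∈ μ, f c < μ.card) ∧ Set.InjOn f μ.cells ∧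
    ∀ c ∈ μ, ∀ d ∈ μ, c ≤ d → c ≠ d → f c < f d}

theorem dimYD_eq_ncard_fillings (μ : YoungDiagram) : dimYD μ = μ.fillings.ncard := by
  rw [dimYD, ← Nat.card_coe_set_eq]
  let F : (μ.cells ≃ Fin μ.card) → ℕ × ℕ → ℕ :=
    fun T c => if h : c ∈ μ.cells then (T ⟨c, h⟩ : ℕ) else 0
  have hF : ∀ T (c : μ.cells), F T c.1 = T c := fun T c => by simp [F]
  have hF' : ∀ c, c ∈ μ → ∃ e : μ.cells, e.1 = c := fun c h => ⟨⟨c, h⟩, rfl⟩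
  refine Nat.card_eq_of_bijective (α := {T : μ.cells ≃ Fin μ.card //
      ∀ c d : μ.cells, c.1.1 ≤ d.1.1 → c.1.2 ≤ d.1.2 → c ≠ d → T c < T d})
    (fun T => ⟨F T.1, ?_, ?_, ?_, ?_⟩) ⟨?_, ?_⟩
  · intro c hc
    exact dif_neg hc
  · intro c hc
    obtain ⟨c, rfl⟩ := hF' c hc
    rw [hF]
    exact (T.1 c).2
  · intro c hc d hd h
    obtain ⟨c, rfl⟩ := hF' c hc
    obtain ⟨d, rfl⟩ := hF' d hd
    rw [hF, hF] at h
    rw [T.1.injective (Fin.ext h)]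
  · intro c hc d hd h hne
    obtain ⟨c, rfl⟩ := hF' c hc
    obtain ⟨d, rfl⟩ := hF' d hd
    rw [hF, hF]
    exact T.2 c d h.1 h.2 (fun e => hne (by rw [e]))
  · intro T T' h
    refine Subtype.ext (Equiv.ext fun c => Fin.ext ?_)
    rw [← hF, ← hF]
    exact congrFun (congrArg Subtype.val h) c.1
  · rintro ⟨f, h0, hlt, hinj, hmono⟩
    let g : μ.cells → Fin μ.card := fun c => ⟨f c.1, hlt c.1 c.2⟩
    have hg : Function.Bijective g := by
      rw [Fintype.bijective_iff_injective_and_card]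
      refine ⟨fun c d h => Subtype.ext (hinj c.2 d.2 (Fin.ext_iff.1 h)), by simp⟩
    refine ⟨⟨Equiv.ofBijective g hg, fun c d h1 h2 hne => ?_⟩, Subtype.ext (funext fun c => ?_)⟩
    · exact hmono c.1 c.2 d.1 d.2 ⟨h1, h2⟩ (fun e => hne (Subtype.ext e))
    · by_cases hc : c ∈ μ.cells
      · exact dif_pos hc
      · simp only [F, hc, dite_false]
        exact (h0 c hc).symm

theorem finite_fillings (μ : YoungDiagram) : μ.fillings.Finite := by
  refine Set.Finite.of_finite_image (f := fun f (c : μ.cells) => f c.1)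
    ((Set.Finite.pi' (fun _ : μ.cells => Set.finite_Iio μ.card)).subset ?_) ?_
  · rintro _ ⟨f, hf, rfl⟩ c
    exact hf.2.1 c.1 c.2
  · intro f hf g hg h
    funext c
    by_cases hc : c ∈ μ
    · exact congrFun h ⟨c, hc⟩
    · rw [hf.1 c hc, hg.1 c hc]

theorem image_fillings {μ : YoungDiagram} {f : ℕ × ℕ → ℕ} (hf : f ∈ μ.fillings) :
    μ.cells.image f = range μ.card := by
  refine Finset.eq_of_subset_of_card_le ?_ ?_
  · intro k hk
    obtain ⟨c, hc, rfl⟩ := Finset.mem_image.1 hk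
    exact Finset.mem_range.2 (hf.2.1 c hc)
  · rw [Finset.card_image_of_injOn hf.2.2.1, card_range]

/-- The boxes of `μ` that carry an entry smaller than `n`. -/
noncomputable def restrictLT (μ : YoungDiagram) (n : ℕ) (f : ℕ × ℕ → ℕ)
    (hf : f ∈ μ.fillings) : YoungDiagram where
  cells := {c ∈ μ.cells | f c < n}
  isLowerSet := by
    intro d c hcd hd
    simp only [coe_filter, mem_cells, Set.mem_ofPred_eq] at hd ⊢
    have hc : c ∈ μ := μ.isLowerSet hcd hd.1
    refine ⟨hc, ?_⟩
    by_cases h : c = d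
    · exact h ▸ hd.2
    · exact (hf.2.2.2 c hc d hd.1 hcd h).trans hd.2

theorem restrictLT_mem_lower {μ : YoungDiagram} {n : ℕ} (hn : μ.card = n + 1) {f : ℕ × ℕ → ℕ}
    (hf : f ∈ μ.fillings) : μ.restrictLT n f hf ∈ μ.lower := by
  rw [mem_lower]
  refine ⟨Finset.filter_subset _ _, ?_⟩
  have h1 : (μ.restrictLT n f hf).cells.image f = range n := by
    ext k
    have hk := Finset.ext_iff.1 (image_fillings hf) k
    simp only [Finset.mem_image, Finset.mem_range, restrictLT, Finset.mem_filter, hn] at hk ⊢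
    constructor
    · rintro ⟨c, ⟨_, hc⟩, rfl⟩
      exact hc
    · intro h
      obtain ⟨c, hc, rfl⟩ := hk.2 (by omega)
      exact ⟨c, ⟨hc, h⟩, rfl⟩
  have hsub : (μ.restrictLT n f hf).cells ⊆ μ.cells := Finset.filter_subset _ _
  have h2 := congrArg Finset.card h1
  rw [Finset.card_image_of_injOn (hf.2.2.1.mono (Finset.coe_subset.2 hsub)), card_range] at h2
  rw [hn]
  exact congrArg (· + 1) h2.symm

theorem sum_lower_dimYD {μ : YoungDiagram} (hμ : μ.card ≠ 0) :
    ∑ ν ∈ μ.lower, dimYD ν = dimYD μ := by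
  obtain ⟨n, hn⟩ := Nat.exists_eq_succ_of_ne_zero hμ
  let r : (ℕ × ℕ → ℕ) → YoungDiagram := fun f =>
    if hf : f ∈ μ.fillings then μ.restrictLT n f hf else ⊥
  have hr : ∀ f, f ∈ μ.fillings → ∀ c, c ∈ r f ↔ c ∈ μ ∧ f c < n := by
    intro f hf c
    simp only [r, hf, dite_true, restrictLT]
    rw [← mem_cells, Finset.mem_filter, mem_cells]
  rw [dimYD_eq_ncard_fillings, Set.ncard_eq_toFinset_card _ μ.finite_fillings,
    Finset.card_eq_sum_card_fiberwise (f := r) (t := μ.lower)]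
  swap
  · intro f hf
    have hf : f ∈ μ.fillings := by simpa using hf
    simp only [r, hf, dite_true]
    exact restrictLT_mem_lower hn hf
  refine Finset.sum_congr rfl fun ν hν => ?_
  obtain ⟨hle, hcard⟩ := mem_lower.1 hν
  have hνn : ν.card = n := by omega
  obtain ⟨b, hb⟩ : ∃ b, μ.cells \ ν.cells = {b} := by
    rw [← Finset.card_eq_one, Finset.card_sdiff_of_subset hle]
    have : μ.cells.card = ν.cells.card + 1 := hcard
    omega
  have hb' : ∀ c, c ∈ μ → c ∉ ν → c = b := fun c h1 h2 => by
    rw [← Finset.mem_singleton, ← hb, Finset.mem_sdiff]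
    exact ⟨h1, h2⟩
  rw [dimYD_eq_ncard_fillings, Set.ncard_eq_toFinset_card _ ν.finite_fillings]
  symm
  refine Finset.card_bij (fun f _ c => if c ∈ ν then f c else 0) ?_ ?_ ?_
  · intro f hf
    simp only [Finset.mem_filter, Set.Finite.mem_toFinset] at hf ⊢
    obtain ⟨hf, rfl⟩ := hf
    refine ⟨fun c hc => if_neg hc, fun c hc => ?_, fun c hc d hd h => ?_,
      fun c hc d hd h hne => ?_⟩
    · simp only [if_pos hc, hνn]
      exact ((hr f hf c).1 hc).2
    · have hc : c ∈ r f := hc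
      have hd : d ∈ r f := hd
      simp only [if_pos hc, if_pos hd] at h
      exact hf.2.2.1 (hle hc) (hle hd) h
    · simp only [if_pos hc, if_pos hd]
      exact hf.2.2.2 c (hle hc) d (hle hd) h hne
  · intro f hf g hg h
    simp only [Finset.mem_filter, Set.Finite.mem_toFinset] at hf hg
    funext c
    by_cases hc : c ∈ ν
    · simpa [hc] using congrFun h c
    by_cases hcm : c ∈ μ
    · have h1 := hr f hf.1 c
      have h2 := hr g hg.1 c
      rw [hf.2] at h1
      rw [hg.2] at h2
      have h3 := hf.1.2.1 c hcm
      have h4 := hg.1.2.1 c hcm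
      simp only [hc, hcm, true_and, false_iff] at h1 h2
      omega
    · rw [hf.1.1 c hcm, hg.1.1 c hcm]
  · intro g hg
    simp only [Set.Finite.mem_toFinset] at hg
    let f : ℕ × ℕ → ℕ := fun c => if c ∈ ν then g c else if c ∈ μ then n else 0
    have f1 : ∀ c, c ∈ ν → f c = g c := fun c h => by simp [f, h]
    have f2 : ∀ c, c ∈ μ → c ∉ ν → f c = n := fun c h h' => by simp [f, h, h']
    have hlt : ∀ c, c ∈ ν → f c < n := fun c h => by
      rw [f1 c h, ← hνn]
      exact hg.2.1 c h
    have hf : f ∈ μ.fillings := by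
      refine ⟨fun c hc => ?_, fun c hc => ?_, fun c hc d hd h => ?_, fun c hc d hd h hne => ?_⟩
      · simp only [f, if_neg (show c ∉ ν from fun h => hc (hle h)), if_neg hc]
      · by_cases h : c ∈ ν
        · have := hlt c h
          omega
        · rw [f2 c hc h]
          omega
      · have hc : c ∈ μ := hc
        have hd : d ∈ μ := hd
        by_cases hcν : c ∈ ν <;> by_cases hdν : d ∈ ν
        · rw [f1 c hcν, f1 d hdν] at h
          exact hg.2.2.1 hcν hdν h
        · have := hlt c hcν
          have := f2 d hd hdν
          omega
        · have := hlt d hdν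
          have := f2 c hc hcν
          omega
        · rw [hb' c hc hcν, hb' d hd hdν]
      · by_cases hdν : d ∈ ν
        · have hcν : c ∈ ν := ν.isLowerSet h hdν
          rw [f1 c hcν, f1 d hdν]
          exact hg.2.2.2 c hcν d hdν h hne
        · have hcν : c ∈ ν := by
            by_contra hcν
            exact hne ((hb' c hc hcν).trans (hb' d hd hdν).symm)
          rw [f2 d hd hdν]
          exact hlt c hcν
    refine ⟨f, ?_, ?_⟩
    · simp only [Finset.mem_filter, Set.Finite.mem_toFinset]
      refine ⟨hf, YoungDiagram.ext (Finset.ext fun c => ?_)⟩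
      rw [mem_cells, mem_cells, hr f hf]
      constructor
      · rintro ⟨h1, h2⟩
        by_contra h
        rw [f2 c h1 h] at h2
        omega
      · exact fun h => ⟨hle h, hlt c h⟩
    · funext c
      by_cases h : c ∈ ν
      · simp [h, f1]
      · simp [h, hg.1 c h]

/-- The diagram obtained from `ν` by adding a box at the end of row `i`. -/
def addBox (ν : YoungDiagram) (i : ℕ) (hi : ∀ k < i, ν.rowLen i < ν.rowLen k) :
    YoungDiagram where
  cells := insert (i, ν.rowLen i) ν.cells
  isLowerSet := by
    rintro ⟨a, b⟩ ⟨a', b'⟩ ⟨h1, h2⟩ h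
    dsimp only at h1 h2
    simp only [coe_insert, Set.mem_insert_iff, Prod.mk.injEq, Finset.mem_coe, mem_cells] at h ⊢
    rcases h with ⟨rfl, rfl⟩ | h
    · rcases h1.lt_or_eq with h1 | rfl
      · exact Or.inr (mem_iff_lt_rowLen.2 (h2.trans_lt (hi _ h1)))
      · rcases h2.lt_or_eq with h2 | rfl
        · exact Or.inr (mem_iff_lt_rowLen.2 h2)
        · exact Or.inl ⟨rfl, rfl⟩
    · exact Or.inr (ν.up_left_mem h1 h2 h)

/-- The diagram obtained from `ν` by removing the last box of row `i`. -/
def removeBox (ν : YoungDiagram) (i : ℕ) (hi : ν.rowLen (i + 1) < ν.rowLen i) :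
    YoungDiagram where
  cells := ν.cells.erase (i, ν.rowLen i - 1)
  isLowerSet := by
    rintro ⟨a, b⟩ ⟨a', b'⟩ ⟨h1, h2⟩ h
    dsimp only at h1 h2
    simp only [coe_erase, Set.mem_sdiff, Set.mem_singleton_iff, Prod.mk.injEq, Finset.mem_coe,
      mem_cells] at h ⊢
    refine ⟨ν.up_left_mem h1 h2 h.1, ?_⟩
    rintro ⟨rfl, rfl⟩
    have h3 := mem_iff_lt_rowLen.1 h.1
    rcases h1.lt_or_eq with h1 | rfl
    · have := ν.rowLen_anti (a' + 1) a h1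
      omega
    · exact h.2 ⟨rfl, by omega⟩

/-- The rows of `ν` from which a box can be removed. -/
def corners (ν : YoungDiagram) : Finset ℕ :=
  {i ∈ range (ν.colLen 0) | ν.rowLen (i + 1) < ν.rowLen i}

theorem mem_corners {ν : YoungDiagram} {i : ℕ} :
    i ∈ ν.corners ↔ ν.rowLen (i + 1) < ν.rowLen i := by
  simp only [corners, Finset.mem_filter, Finset.mem_range, and_iff_right_iff_imp]
  intro h
  rw [← mem_iff_lt_colLen, mem_iff_lt_rowLen]
  omega

theorem mem_insert_image_corners {ν : YoungDiagram} {i : ℕ} :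
    i ∈ insert 0 (ν.corners.image (· + 1)) ↔ ∀ k < i, ν.rowLen i < ν.rowLen k := by
  simp only [Finset.mem_insert, Finset.mem_image, mem_corners]
  constructor
  · rintro (rfl | ⟨j, hj, rfl⟩) k hk
    · omega
    · exact hj.trans_le (ν.rowLen_anti k j (by omega))
  · intro h
    rcases i with _ | j
    · exact Or.inl rfl
    · exact Or.inr ⟨j, h j (by omega), rfl⟩

theorem card_lower (ν : YoungDiagram) : ν.lower.card = ν.corners.card := by
  symm
  have hmem : ∀ i, i ∈ ν.corners → (i, ν.rowLen i - 1) ∈ ν.cells := fun i hi => by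
    rw [mem_cells, mem_iff_lt_rowLen]
    have := mem_corners.1 hi
    omega
  refine Finset.card_bij (fun i hi => ν.removeBox i (mem_corners.1 hi)) ?_ ?_ ?_
  · intro i hi
    rw [mem_lower]
    exact ⟨Finset.erase_subset _ _, (Finset.card_erase_add_one (hmem i hi)).symm⟩
  · intro i hi j hj h
    have h := congrArg cells h
    simp only [removeBox] at h
    by_contra hne
    have : (i, ν.rowLen i - 1) ∈ ν.cells.erase (j, ν.rowLen j - 1) :=
      Finset.mem_erase.2 ⟨by simp [hne], hmem i hi⟩
    rw [← h] at this
    simp at this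
  · intro κ hκ
    obtain ⟨hle, hcard⟩ := mem_lower.1 hκ
    obtain ⟨⟨i, j⟩, hb⟩ : ∃ b, ν.cells \ κ.cells = {b} := by
      rw [← Finset.card_eq_one, Finset.card_sdiff_of_subset hle]
      have : ν.cells.card = κ.cells.card + 1 := hcard
      omega
    have hb' : ∀ c, c ∈ ν ∧ c ∉ κ ↔ c = (i, j) := fun c => by
      rw [← Finset.mem_singleton, ← hb, Finset.mem_sdiff, mem_cells, mem_cells]
    obtain ⟨h1, h2⟩ := (hb' (i, j)).2 rfl
    have h3 : (i, j + 1) ∉ ν := fun h => by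
      have : (i, j + 1) ∉ κ := fun h' => h2 (κ.up_left_mem le_rfl (Nat.le_succ _) h')
      simpa using (hb' _).1 ⟨h, this⟩
    have h4 : (i + 1, j) ∉ ν := fun h => by
      have : (i + 1, j) ∉ κ := fun h' => h2 (κ.up_left_mem (Nat.le_succ _) le_rfl h')
      simpa using (hb' _).1 ⟨h, this⟩
    rw [mem_iff_lt_rowLen] at h1 h3 h4
    have hi : ν.rowLen (i + 1) < ν.rowLen i := by omega
    refine ⟨i, mem_corners.2 hi, (eq_of_le_of_card_le ?_ ?_).symm⟩
    · intro c hc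
      refine Finset.mem_erase.2 ⟨?_, hle hc⟩
      rintro rfl
      rw [show ν.rowLen i - 1 = j by omega] at hc
      exact h2 hc
    · have := Finset.card_erase_add_one (hmem i (mem_corners.2 hi))
      simp only [removeBox, YoungDiagram.card] at hcard ⊢
      omega

theorem card_upper (ν : YoungDiagram) : ν.upper.card = ν.lower.card + 1 := by
  have hA : (insert 0 (ν.corners.image (· + 1))).card = ν.lower.card + 1 := by
    rw [Finset.card_insert_of_notMem (by simp), Finset.card_image_of_injective _
      (add_left_injective 1), card_lower]
  rw [← hA]
  symm
  have hmem : ∀ i, (i, ν.rowLen i) ∉ ν.cells := fun i => by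
    rw [mem_cells, mem_iff_lt_rowLen]
    omega
  refine Finset.card_bij (fun i hi => ν.addBox i (mem_insert_image_corners.1 hi)) ?_ ?_ ?_
  · intro i hi
    rw [mem_upper]
    exact ⟨Finset.subset_insert _ _, Finset.card_insert_of_notMem (hmem i)⟩
  · intro i hi j hj h
    have h := congrArg cells h
    simp only [addBox] at h
    have : (i, ν.rowLen i) ∈ insert (j, ν.rowLen j) ν.cells := h ▸ Finset.mem_insert_self _ _
    rcases Finset.mem_insert.1 this with h | h
    · exact (Prod.mk.inj h).1
    · exact absurd h (hmem i)
  · intro κ hκ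
    obtain ⟨hle, hcard⟩ := mem_upper.1 hκ
    obtain ⟨⟨i, j⟩, hb⟩ : ∃ b, κ.cells \ ν.cells = {b} := by
      rw [← Finset.card_eq_one, Finset.card_sdiff_of_subset hle]
      have : κ.cells.card = ν.cells.card + 1 := hcard
      omega
    have hb' : ∀ c, c ∈ κ ∧ c ∉ ν ↔ c = (i, j) := fun c => by
      rw [← Finset.mem_singleton, ← hb, Finset.mem_sdiff, mem_cells, mem_cells]
    obtain ⟨h1, h2⟩ := (hb' (i, j)).2 rfl
    have hlt : ∀ a b, a ≤ i → b ≤ j → (a, b) ≠ (i, j) → b < ν.rowLen a := by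
      intro a b ha hb hne
      rw [← mem_iff_lt_rowLen]
      by_contra h
      exact hne ((hb' _).1 ⟨κ.up_left_mem ha hb h1, h⟩)
    rw [mem_iff_lt_rowLen] at h2
    obtain rfl : j = ν.rowLen i := by
      refine le_antisymm ?_ (by omega)
      rcases j with _ | j
      · exact Nat.zero_le _
      · exact hlt i j le_rfl (Nat.le_succ _) (by simp)
    have hi : ∀ k < i, ν.rowLen i < ν.rowLen k := fun k hk =>
      hlt k _ hk.le le_rfl (by simp [hk.ne])
    refine ⟨i, mem_insert_image_corners.2 hi, eq_of_le_of_card_le ?_ ?_⟩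
    · intro c hc
      rcases Finset.mem_insert.1 hc with rfl | hc
      · exact h1
      · exact hle hc
    · have := Finset.card_insert_of_notMem (hmem i)
      simp only [addBox, YoungDiagram.card] at hcard ⊢
      omega

theorem lower_nonempty {ν : YoungDiagram} (hν : ν.card ≠ 0) : ν.lower.Nonempty := by
  rw [← Finset.card_pos, card_lower, Finset.card_pos]
  have h0 : 0 < ν.colLen 0 := by
    obtain ⟨⟨i, j⟩, h⟩ := Finset.card_pos.1 (Nat.pos_of_ne_zero hν)
    rw [← mem_iff_lt_colLen]
    exact ν.up_left_mem (Nat.zero_le _) (Nat.zero_le _) h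
  refine ⟨ν.colLen 0 - 1, mem_corners.2 ?_⟩
  have h1 : (ν.colLen 0 - 1, 0) ∈ ν := mem_iff_lt_colLen.2 (by omega)
  have h2 : (ν.colLen 0 - 1 + 1, 0) ∉ ν := fun h => by
    have := mem_iff_lt_colLen.1 h
    omega
  rw [mem_iff_lt_rowLen] at h1 h2
  omega

theorem dimYD_pos (μ : YoungDiagram) : 0 < dimYD μ := by
  induction h : μ.card generalizing μ with
  | zero =>
    have : IsEmpty μ.cells := Finset.isEmpty_coe_sort.2 (Finset.card_eq_zero.1 h)
    have : IsEmpty (Fin μ.card) := by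
      rw [h]
      infer_instance
    have : Nonempty {T : μ.cells ≃ Fin μ.card //
        ∀ c d : μ.cells, c.1.1 ≤ d.1.1 → c.1.2 ≤ d.1.2 → c ≠ d → T c < T d} :=
      ⟨⟨Equiv.equivOfIsEmpty _ _, fun c => isEmptyElim c⟩⟩
    exact Nat.card_pos
  | succ n ih =>
    rw [← sum_lower_dimYD (by omega)]
    refine Finset.sum_pos (fun ν hν => ih ν ?_) (lower_nonempty (by omega))
    have := (mem_lower.1 hν).2
    omega

theorem card_filter_upper_eq_card_filter_lower {ν κ : YoungDiagram} (hne : κ ≠ ν)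
    (hc : κ.card = ν.card) :
    {μ ∈ ν.upper | κ ∈ μ.lower}.card = {ρ ∈ ν.lower | κ ∈ ρ.upper}.card := by
  have hsi := card_sup_add_card_inf ν κ
  have hup : ∀ μ, μ ∈ ({μ ∈ ν.upper | κ ∈ μ.lower} : Finset _) ↔
      (ν ⊔ κ).card = ν.card + 1 ∧ μ = ν ⊔ κ := by
    intro μ
    rw [Finset.mem_filter, mem_upper, mem_lower]
    constructor
    · rintro ⟨⟨h1, h2⟩, h3, -⟩
      have h4 : ν ⊔ κ ≤ μ := sup_le h1 h3
      have h5 : ν.card < (ν ⊔ κ).card := by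
        by_contra h
        have e1 : ν = ν ⊔ κ := eq_of_le_of_card_le le_sup_left (by omega)
        have e2 : κ = ν ⊔ κ := eq_of_le_of_card_le le_sup_right (by omega)
        exact hne (e2.trans e1.symm)
      have h6 := card_mono h4
      exact ⟨by omega, (eq_of_le_of_card_le h4 (by omega)).symm⟩
    · rintro ⟨h, rfl⟩
      exact ⟨⟨le_sup_left, h⟩, le_sup_right, by omega⟩
  have hlo : ∀ ρ, ρ ∈ ({ρ ∈ ν.lower | κ ∈ ρ.upper} : Finset _) ↔
      (ν ⊔ κ).card = ν.card + 1 ∧ ρ = ν ⊓ κ := by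
    intro ρ
    rw [Finset.mem_filter, mem_upper, mem_lower]
    constructor
    · rintro ⟨⟨h1, h2⟩, h3, -⟩
      have h4 : ρ ≤ ν ⊓ κ := le_inf h1 h3
      have h5 : (ν ⊓ κ).card < ν.card := by
        by_contra h
        have e1 : ν ⊓ κ = ν := eq_of_le_of_card_le inf_le_left (by omega)
        have e2 : ν ⊓ κ = κ := eq_of_le_of_card_le inf_le_right (by omega)
        exact hne (e2.symm.trans e1)
      have h6 := card_mono h4
      exact ⟨by omega, eq_of_le_of_card_le h4 (by omega)⟩
    · rintro ⟨h, rfl⟩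
      exact ⟨⟨inf_le_left, by omega⟩, inf_le_right, by omega⟩
  by_cases h : (ν ⊔ κ).card = ν.card + 1
  · have e1 : ({μ ∈ ν.upper | κ ∈ μ.lower} : Finset _) = {ν ⊔ κ} := by
      ext μ
      simp [hup, h]
    have e2 : ({ρ ∈ ν.lower | κ ∈ ρ.upper} : Finset _) = {ν ⊓ κ} := by
      ext ρ
      simp [hlo, h]
    rw [e1, e2, Finset.card_singleton, Finset.card_singleton]
  · rw [Finset.filter_eq_empty_iff.2 fun μ h1 h2 => h ((hup μ).1 (Finset.mem_filter.2 ⟨h1, h2⟩)).1,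
      Finset.filter_eq_empty_iff.2 fun μ h1 h2 => h ((hlo μ).1 (Finset.mem_filter.2 ⟨h1, h2⟩)).1]

theorem sum_upper_sum_lower (ν : YoungDiagram) (f : YoungDiagram → ℕ) :
    ∑ μ ∈ ν.upper, ∑ κ ∈ μ.lower, f κ = ∑ ρ ∈ ν.lower, ∑ κ ∈ ρ.upper, f κ + f ν := by
  have h1 : ∑ μ ∈ ν.upper, ∑ κ ∈ μ.lower, f κ =
      ∑ κ ∈ ofCard ν.card, ({μ ∈ ν.upper | κ ∈ μ.lower} : Finset _).card * f κ := by
    simp_rw [← smul_eq_mul, ← Finset.sum_const]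
    refine Finset.sum_comm' fun μ κ => ?_
    simp only [Finset.mem_filter, mem_ofCard, mem_upper, mem_lower]
    exact (and_iff_left_of_imp fun h => by omega).symm
  have h2 : ∑ ρ ∈ ν.lower, ∑ κ ∈ ρ.upper, f κ =
      ∑ κ ∈ ofCard ν.card, ({ρ ∈ ν.lower | κ ∈ ρ.upper} : Finset _).card * f κ := by
    simp_rw [← smul_eq_mul, ← Finset.sum_const]
    refine Finset.sum_comm' fun μ κ => ?_
    simp only [Finset.mem_filter, mem_ofCard, mem_upper, mem_lower]
    exact (and_iff_left_of_imp fun h => by omega).symm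
  have hν : ν ∈ ofCard ν.card := by simp
  rw [h1, h2, ← Finset.add_sum_erase _ _ hν, ← Finset.add_sum_erase _ _ hν,
    Finset.filter_true_of_mem fun μ hμ => mem_lower_iff_mem_upper.2 hμ,
    Finset.filter_true_of_mem fun μ hμ => mem_lower_iff_mem_upper.1 hμ, card_upper,
    Finset.sum_congr rfl fun κ hκ => ?_]
  · ring
  · rw [Finset.mem_erase, mem_ofCard] at hκ
    rw [card_filter_upper_eq_card_filter_lower hκ.1 hκ.2]

theorem sum_upper_dimYD (ν : YoungDiagram) :
    ∑ μ ∈ ν.upper, dimYD μ = (ν.card + 1) * dimYD ν := by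
  induction h : ν.card generalizing ν with
  | zero =>
    have hlow : ν.lower = ∅ := by
      refine Finset.eq_empty_of_forall_notMem fun ρ hρ => ?_
      have := (mem_lower.1 hρ).2
      omega
    have := sum_upper_sum_lower ν dimYD
    rw [hlow, Finset.sum_empty, zero_add] at this
    rw [zero_add, one_mul, ← this]
    refine Finset.sum_congr rfl fun μ hμ => (sum_lower_dimYD ?_).symm
    have := (mem_upper.1 hμ).2
    omega
  | succ n ih =>
    have h1 : ∑ μ ∈ ν.upper, dimYD μ = ∑ μ ∈ ν.upper, ∑ κ ∈ μ.lower, dimYD κ := by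
      refine Finset.sum_congr rfl fun μ hμ => (sum_lower_dimYD ?_).symm
      have := (mem_upper.1 hμ).2
      omega
    have h2 : ∑ ρ ∈ ν.lower, ∑ κ ∈ ρ.upper, dimYD κ = ∑ ρ ∈ ν.lower, (n + 1) * dimYD ρ := by
      refine Finset.sum_congr rfl fun ρ hρ => ih ρ ?_
      have := (mem_lower.1 hρ).2
      omega
    rw [h1, sum_upper_sum_lower, h2, ← Finset.mul_sum, sum_lower_dimYD (by omega)]
    ring

end YoungDiagram

section Tuples

open YoungDiagram

variable {ι : Type*}

theorem addBoxAt_iff_mem_upper {ν lam : ι → YoungDiagram} {i : ι} :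
    AddBoxAt ν lam i ↔ lam i ∈ (ν i).upper ∧ Function.update ν i (lam i) = lam := by
  rw [AddBoxAt, mem_upper, Function.update_eq_iff, cells_subset_iff]
  tauto

theorem addBoxAt_iff_mem_lower {ν lam : ι → YoungDiagram} {i : ι} :
    AddBoxAt ν lam i ↔ ν i ∈ (lam i).lower ∧ Function.update lam i (ν i) = ν := by
  rw [AddBoxAt, mem_lower, Function.update_eq_iff, cells_subset_iff]
  simp only [eq_comm, and_comm, true_and]

variable [Fintype ι]

/-- The tuples of Young diagrams of total size `n`. -/
noncomputable def tuplesOfCard (ι : Type*) [Fintype ι] (n : ℕ) : Finset (ι → YoungDiagram) :=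
  {lam ∈ (Set.Finite.pi' fun _ : ι => finite_setOf_card_le n).toFinset | ∑ i, (lam i).card = n}

theorem mem_tuplesOfCard {n : ℕ} {lam : ι → YoungDiagram} :
    lam ∈ tuplesOfCard ι n ↔ ∑ i, (lam i).card = n := by
  simp only [tuplesOfCard, Finset.mem_filter, Set.Finite.mem_toFinset, Set.mem_ofPred_eq,
    and_iff_right_iff_imp]
  rintro rfl i
  exact Finset.single_le_sum (f := fun i => (lam i).card) (fun _ _ => Nat.zero_le _)
    (Finset.mem_univ i)

theorem AddBoxAt.sum_card {ν lam : ι → YoungDiagram} {i : ι} (h : AddBoxAt ν lam i) :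
    ∑ j, (lam j).card = ∑ j, (ν j).card + 1 := by
  rw [← Finset.add_sum_erase _ _ (Finset.mem_univ i),
    ← Finset.add_sum_erase _ (fun j => (ν j).card) (Finset.mem_univ i), h.2.2,
    Finset.sum_congr rfl fun j hj =>
      congrArg YoungDiagram.card (h.1 j (Finset.ne_of_mem_erase hj)).symm]
  ring

/-- The factor that the diagram `μ`, standing at an entry of dimension `d`, contributes to
`DimW`. -/
noncomputable def dimFactor (d : ℕ) (μ : YoungDiagram) : ℝ :=
  d ^ μ.card * dimYD μ / (μ.card).factorial

theorem DimW_eq_factorial_mul_prod (d : ι → ℕ) (lam : ι → YoungDiagram) :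
    (DimW d lam : ℝ) = (∑ i, (lam i).card).factorial * ∏ i, dimFactor (d i) (lam i) := by
  have h : ((∏ i, ((lam i).card).factorial : ℕ) : ℝ) *
      (Nat.multinomial Finset.univ fun i => (lam i).card) = (∑ i, (lam i).card).factorial := by
    exact_mod_cast Nat.multinomial_spec Finset.univ fun i => (lam i).card
  have h0 : ((∏ i, ((lam i).card).factorial : ℕ) : ℝ) ≠ 0 := by
    exact_mod_cast (Finset.prod_pos fun _ _ => Nat.factorial_pos _).ne'
  rw [DimW, ← h]
  simp only [dimFactor, Finset.prod_div_distrib, Finset.prod_mul_distrib]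
  push_cast at h0 ⊢
  field_simp

theorem DimW_pos {d : ι → ℕ} (hd : ∀ i, 0 < d i) (lam : ι → YoungDiagram) : 0 < DimW d lam :=
  Nat.mul_pos (Nat.mul_pos (Nat.multinomial_pos _ _)
    (Finset.prod_pos fun i _ => pow_pos (hd i) _)) (Finset.prod_pos fun _ _ => dimYD_pos _)

theorem sum_upper_dimFactor (d : ℕ) (ν : YoungDiagram) :
    ∑ μ ∈ ν.upper, dimFactor d μ = d * dimFactor d ν := by
  have h : ∀ μ ∈ ν.upper, dimFactor d μ =
      d ^ (ν.card + 1) / (ν.card + 1).factorial * dimYD μ := fun μ hμ => by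
    rw [dimFactor, (mem_upper.1 hμ).2]
    ring
  rw [Finset.sum_congr rfl h, ← Finset.mul_sum, ← Nat.cast_sum, sum_upper_dimYD, dimFactor,
    Nat.factorial_succ]
  push_cast
  field_simp
  ring

theorem mul_sum_lower_dimFactor (d : ℕ) (μ : YoungDiagram) :
    d * ∑ ν ∈ μ.lower, dimFactor d ν = μ.card * dimFactor d μ := by
  rcases hn : μ.card with _ | n
  · have hlow : μ.lower = ∅ := by
      refine Finset.eq_empty_of_forall_notMem fun ρ hρ => ?_
      have := (mem_lower.1 hρ).2
      omega
    simp [hlow]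
  have h : ∀ ν ∈ μ.lower, dimFactor d ν = d ^ n / n.factorial * dimYD ν := fun ν hν => by
    have := (mem_lower.1 hν).2
    rw [dimFactor, show ν.card = n by omega]
    ring
  rw [Finset.sum_congr rfl h, ← Finset.mul_sum, ← Nat.cast_sum, sum_lower_dimYD (by omega),
    dimFactor, hn, Nat.factorial_succ]
  push_cast
  field_simp
  ring

theorem prod_dimFactor_update (d : ι → ℕ) (lam : ι → YoungDiagram) (i : ι) (μ : YoungDiagram) :
    ∏ j, dimFactor (d j) (Function.update lam i μ j) =
      dimFactor (d i) μ * ∏ j ∈ Finset.univ.erase i, dimFactor (d j) (lam j) := by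
  rw [← Finset.mul_prod_erase _ _ (Finset.mem_univ i), Function.update_self]
  congr 1
  refine Finset.prod_congr rfl fun j hj => ?_
  rw [Function.update_of_ne (Finset.ne_of_mem_erase hj)]

theorem sum_addBoxAt_upper_DimW (d : ι → ℕ) (ν : ι → YoungDiagram) (i : ι) :
    ∑ mu ∈ tuplesOfCard ι (∑ j, (ν j).card + 1) with AddBoxAt ν mu i, (DimW d mu : ℝ) =
      (∑ j, (ν j).card + 1 : ℕ) * d i * DimW d ν := by
  have h : ∑ mu ∈ tuplesOfCard ι (∑ j, (ν j).card + 1) with AddBoxAt ν mu i, (DimW d mu : ℝ) =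
      ∑ μ ∈ (ν i).upper, ((∑ j, (ν j).card + 1).factorial : ℝ) *
        ∏ j, dimFactor (d j) (Function.update ν i μ j) := by
    refine Finset.sum_nbij' (fun mu => mu i) (fun μ => Function.update ν i μ) ?_ ?_ ?_ ?_ ?_
    · exact fun mu hmu => (addBoxAt_iff_mem_upper.1 (Finset.mem_filter.1 hmu).2).1
    · intro μ hμ
      have h : AddBoxAt ν (Function.update ν i μ) i := by
        rw [addBoxAt_iff_mem_upper]
        simpa using hμ
      exact Finset.mem_filter.2 ⟨mem_tuplesOfCard.2 h.sum_card, h⟩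
    · exact fun mu hmu => (addBoxAt_iff_mem_upper.1 (Finset.mem_filter.1 hmu).2).2
    · intro μ _
      exact Function.update_self _ _ _
    · intro mu hmu
      have h := (Finset.mem_filter.1 hmu).2
      rw [(addBoxAt_iff_mem_upper.1 h).2, DimW_eq_factorial_mul_prod, h.sum_card]
  rw [h, ← Finset.mul_sum]
  simp only [prod_dimFactor_update]
  rw [← Finset.sum_mul, sum_upper_dimFactor, DimW_eq_factorial_mul_prod d ν, Nat.factorial_succ,
    ← Finset.mul_prod_erase _ (fun j => dimFactor (d j) (ν j)) (Finset.mem_univ i)]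
  push_cast
  ring

theorem mul_sum_addBoxAt_lower_DimW (d : ι → ℕ) {n : ℕ} (lam : ι → YoungDiagram)
    (hlam : ∑ j, (lam j).card = n + 1) (i : ι) :
    d i * ∑ ν ∈ tuplesOfCard ι n with AddBoxAt ν lam i, (DimW d ν : ℝ) =
      n.factorial * (∏ j, dimFactor (d j) (lam j)) * (lam i).card := by
  have h : ∑ ν ∈ tuplesOfCard ι n with AddBoxAt ν lam i, (DimW d ν : ℝ) =
      ∑ κ ∈ (lam i).lower, (n.factorial : ℝ) *
        ∏ j, dimFactor (d j) (Function.update lam i κ j) := by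
    refine Finset.sum_nbij' (fun ν => ν i) (fun κ => Function.update lam i κ) ?_ ?_ ?_ ?_ ?_
    · exact fun ν hν => (addBoxAt_iff_mem_lower.1 (Finset.mem_filter.1 hν).2).1
    · intro κ hκ
      have h : AddBoxAt (Function.update lam i κ) lam i := by
        rw [addBoxAt_iff_mem_lower]
        simpa using hκ
      have := h.sum_card
      exact Finset.mem_filter.2 ⟨mem_tuplesOfCard.2 (by omega), h⟩
    · exact fun ν hν => (addBoxAt_iff_mem_lower.1 (Finset.mem_filter.1 hν).2).2
    · intro μ _
      exact Function.update_self _ _ _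
    · intro ν hν
      obtain ⟨h1, h⟩ := Finset.mem_filter.1 hν
      rw [(addBoxAt_iff_mem_lower.1 h).2, DimW_eq_factorial_mul_prod, mem_tuplesOfCard.1 h1]
  rw [h, ← Finset.mul_sum]
  simp only [prod_dimFactor_update]
  rw [← Finset.sum_mul, ← Finset.mul_prod_erase _ (fun j => dimFactor (d j) (lam j))
    (Finset.mem_univ i)]
  linear_combination (n.factorial : ℝ) * (∏ j ∈ Finset.univ.erase i, dimFactor (d j) (lam j)) *
    mul_sum_lower_dimFactor (d i) (lam i)

/-- The weight `dim ζ_{νλ}` of the edge `ν ↗ λ`, and zero when `ν ↗ λ` does not hold. -/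
noncomputable def edgeWeight (d : ι → ℕ) (ν lam : ι → YoungDiagram) : ℝ :=
  ∑ i, if AddBoxAt ν lam i then (d i : ℝ) else 0

theorem sum_edgeWeight_mul_DimW_upper (d : ι → ℕ) (ν : ι → YoungDiagram) :
    ∑ mu ∈ tuplesOfCard ι (∑ j, (ν j).card + 1), edgeWeight d ν mu * DimW d mu =
      (∑ j, (ν j).card + 1 : ℕ) * (∑ i, (d i : ℝ) ^ 2) * DimW d ν := by
  simp only [edgeWeight, Finset.sum_mul, ite_mul, zero_mul]
  rw [Finset.sum_comm]
  simp only [← Finset.sum_filter, ← Finset.mul_sum, sum_addBoxAt_upper_DimW]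
  rw [Finset.mul_sum, Finset.sum_mul]
  exact Finset.sum_congr rfl fun i _ => by ring

theorem sum_edgeWeight_mul_DimW_lower (d : ι → ℕ) {n : ℕ} (lam : ι → YoungDiagram)
    (hlam : ∑ j, (lam j).card = n + 1) :
    ∑ ν ∈ tuplesOfCard ι n, edgeWeight d ν lam * DimW d ν = DimW d lam := by
  simp only [edgeWeight, Finset.sum_mul, ite_mul, zero_mul]
  rw [Finset.sum_comm]
  simp only [← Finset.sum_filter, ← Finset.mul_sum, mul_sum_addBoxAt_lower_DimW d lam hlam]
  rw [← Nat.cast_sum, hlam, DimW_eq_factorial_mul_prod d lam, hlam, Nat.factorial_succ]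
  push_cast
  ring

theorem Pmat_eq (d : ι → ℕ) {n : ℕ} {lam : ι → YoungDiagram}
    (hlam : ∑ j, (lam j).card = n + 1) (mu : ι → YoungDiagram) :
    Pmat d (n + 1) lam mu =
      (∑ ν ∈ tuplesOfCard ι n, edgeWeight d ν lam * edgeWeight d ν mu) * DimW d mu /
        ((n + 1 : ℕ) * (∑ i, (d i : ℝ) ^ 2) * DimW d lam) := by
  have h : ∀ ν : ι → YoungDiagram, (∑ i, ∑ j,
      if AddBoxAt ν lam i ∧ AddBoxAt ν mu j then (d i * d j : ℝ) else 0) =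
      edgeWeight d ν lam * edgeWeight d ν mu := fun ν => by
    rw [edgeWeight, edgeWeight, Finset.sum_mul_sum]
    refine Finset.sum_congr rfl fun i _ => Finset.sum_congr rfl fun j _ => ?_
    by_cases h1 : AddBoxAt ν lam i <;> by_cases h2 : AddBoxAt ν mu j <;> simp [h1, h2]
  simp only [Pmat, h]
  rw [finsum_eq_sum_of_support_subset]
  · push_cast
    rfl
  intro ν hν
  obtain ⟨i, -, hi⟩ := Finset.exists_ne_zero_of_sum_ne_zero (left_ne_zero_of_mul hν)
  have h1 : AddBoxAt ν lam i := by
    by_contra h1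
    exact hi (if_neg h1)
  have := h1.sum_card
  exact mem_tuplesOfCard.2 (by omega)

end Tuples

/-- The Res–Ind matrix `P` on `𝕐_n(T̂)` is stochastic (rows sum to `1`) and reversible
with respect to the Plancherel measure: `M_Pl(λ)P_{λμ} = M_Pl(μ)P_{μλ}`. -/
theorem resInd_stochastic_and_reversible {ι : Type*} [Fintype ι]
    (d : ι → ℕ) (hd : ∀ i, 0 < d i) (n : ℕ) (hn : 0 < n) :
    (∀ lam : ι → YoungDiagram, (∑ i, (lam i).card) = n →
      ∑ᶠ mu : {mu : ι → YoungDiagram // (∑ i, (mu i).card) = n},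
        Pmat d n lam (mu : ι → YoungDiagram) = 1) ∧
    (∀ lam mu : ι → YoungDiagram, (∑ i, (lam i).card) = n → (∑ i, (mu i).card) = n →
      MPl d n lam * Pmat d n lam mu = MPl d n mu * Pmat d n mu lam) := by
  obtain ⟨n, rfl⟩ := Nat.exists_eq_succ_of_ne_zero hn.ne'
  rw [Nat.succ_eq_add_one]
  have hpos : ∀ lam : ι → YoungDiagram, (DimW d lam : ℝ) ≠ 0 := fun lam => by
    exact_mod_cast (DimW_pos hd lam).ne'
  have hT : ∀ lam : ι → YoungDiagram, ∑ i, (lam i).card = n + 1 → ∑ i, (d i : ℝ) ^ 2 ≠ 0 := by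
    intro lam hlam
    obtain ⟨i, -, -⟩ := Finset.exists_ne_zero_of_sum_ne_zero (hlam.trans_ne n.succ_ne_zero)
    have : (0 : ℝ) < d i := by exact_mod_cast hd i
    exact (Finset.sum_pos' (fun j _ => by positivity) ⟨i, Finset.mem_univ i, by positivity⟩).ne'
  refine ⟨fun lam hlam => ?_, fun lam mu hlam hmu => ?_⟩
  · have hsum : ∑ᶠ mu : {mu : ι → YoungDiagram // ∑ i, (mu i).card = n + 1},
        Pmat d (n + 1) lam (mu : ι → YoungDiagram) =
        ∑ mu ∈ tuplesOfCard ι (n + 1), Pmat d (n + 1) lam mu := by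
      rw [finsum_subtype_eq_finsum_cond (f := fun mu => Pmat d (n + 1) lam mu)
        (fun mu => ∑ i, (mu i).card = n + 1), ← finsum_mem_coe_finset]
      simp only [Finset.mem_coe, mem_tuplesOfCard]
    have hnum : ∑ mu ∈ tuplesOfCard ι (n + 1),
        (∑ ν ∈ tuplesOfCard ι n, edgeWeight d ν lam * edgeWeight d ν mu) * DimW d mu =
        (n + 1 : ℕ) * (∑ i, (d i : ℝ) ^ 2) * DimW d lam := by
      rw [← sum_edgeWeight_mul_DimW_lower d lam hlam, Finset.mul_sum]
      simp only [Finset.sum_mul]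
      rw [Finset.sum_comm]
      refine Finset.sum_congr rfl fun ν hν => ?_
      have h := sum_edgeWeight_mul_DimW_upper d ν
      rw [mem_tuplesOfCard.1 hν] at h
      rw [mul_left_comm, ← h, Finset.mul_sum]
      exact Finset.sum_congr rfl fun mu _ => by ring
    rw [hsum]
    simp only [Pmat_eq d hlam]
    rw [← Finset.sum_div, hnum]
    exact div_self (mul_ne_zero (mul_ne_zero (by positivity) (hT lam hlam)) (hpos lam))
  · rw [Pmat_eq d hlam, Pmat_eq d hmu, MPl, MPl]
    have h1 := hpos lam
    have h2 := hpos mu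
    have h3 := hT lam hlam
    simp only [mul_comm (edgeWeight d _ mu)]
    push_cast
    field_simp
end
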